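/- arXiv:1810.10842 — 3 statements merged into one kernel-verified Lean document; each statement's English description precedes it below -/
import Mathlib

section
/- There exist positive real constants c₁ and c₂ and a threshold N such that for every finite set A ⊆ ℝ with |A| ≥ N and |A+A| ≤ |A|^(1+c₁), the triple product set satisfies |AAA| ≥ |A|^(2+c₂). -/
open Finset Pointwise

/-- A choice of immediate successors in a finite set of reals. -/
lemma exists_next (S : Finset ℝ) : ∃ f : ℝ → ℝ, ∀ a, (∃ x ∈ S, a < x) →
    f a ∈ S ∧ a < f a ∧ ∀ b ∈ S, a < b → f a ≤ b := by
  have key : ∀ a : ℝ, ∃ c : ℝ, (∃ x ∈ S, a < x) → c ∈ S ∧ a < c ∧ ∀ b ∈ S, a < b → c ≤ b := by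
    intro a
    by_cases h : ∃ x ∈ S, a < x
    · obtain ⟨x, hx, hax⟩ := h
      obtain ⟨c, hc, hmin⟩ := exists_min_image (S.filter (a < ·)) id
        ⟨x, mem_filter.2 ⟨hx, hax⟩⟩
      rw [mem_filter] at hc
      exact ⟨c, fun _ => ⟨hc.1, hc.2, fun b hb hab => hmin b (mem_filter.2 ⟨hb, hab⟩)⟩⟩
    · exact ⟨0, fun h' => absurd h' h⟩
  choose f hf using key
  exact ⟨f, hf⟩

lemma card_le_card_filter_exists_lt_add_one (S : Finset ℝ) :
    #S ≤ #(S.filter fun a => ∃ x ∈ S, a < x) + 1 := by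
  have h1 : #(S.filter fun a => ¬ ∃ x ∈ S, a < x) ≤ 1 := by
    rw [card_le_one]
    intro a ha b hb
    simp only [mem_filter, not_exists, not_and, not_lt] at ha hb
    exact le_antisymm (hb.2 a ha.1) (ha.2 b hb.1)
  have h2 := card_filter_add_card_filter_not (s := S) (fun a => ∃ x ∈ S, a < x)
  omega

/-- A set with small `S + S - S` has a popular difference between consecutive elements. -/
lemma exists_popular_gap (S : Finset ℝ) (hS : 2 ≤ #S) :
    ∃ d : ℝ, 0 < d ∧ ∃ S' ⊆ S, (∀ a ∈ S', a + d ∈ S ∧ ∀ b ∈ S, a < b → a + d ≤ b) ∧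
      (#S - 1) ^ 2 ≤ 2 * (#S' * #(S + S - S)) := by
  obtain ⟨f, hf⟩ := exists_next S
  set S₀ := S.filter fun a => ∃ x ∈ S, a < x with hS₀
  have hcard : #S ≤ #S₀ + 1 := card_le_card_filter_exists_lt_add_one S
  have hne : S₀.Nonempty := by rw [← card_pos]; omega
  have hf' : ∀ a ∈ S₀, a ∈ S ∧ f a ∈ S ∧ a < f a ∧ ∀ b ∈ S, a < b → f a ≤ b := fun a ha =>
    ⟨(mem_filter.1 ha).1, hf a (mem_filter.1 ha).2⟩
  obtain ⟨j₀, hj₀, hmax⟩ := exists_max_image S₀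
    (fun j => #(S₀.filter fun i => f i - i = f j - j)) hne
  refine ⟨f j₀ - j₀, sub_pos.2 (hf' j₀ hj₀).2.2.1, S₀.filter fun i => f i - i = f j₀ - j₀,
    (filter_subset _ _).trans (filter_subset _ _), ?_, ?_⟩
  · intro a ha
    rw [mem_filter] at ha
    obtain ⟨_, h1, _, h2⟩ := hf' a ha.1
    rw [← ha.2, add_sub_cancel]
    exact ⟨h1, h2⟩
  set M := #(S₀.filter fun i => f i - i = f j₀ - j₀)
  set Q := (S₀ ×ˢ S₀).filter fun p => f p.2 - p.2 ≤ f p.1 - p.1 with hQ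
  have hQcard : #S₀ ^ 2 ≤ 2 * #Q := by
    have h1 : S₀ ×ˢ S₀ ⊆ Q ∪ Q.image Prod.swap := by
      rintro ⟨i, j⟩ h
      rw [mem_product] at h
      rcases le_total (f j - j) (f i - i) with h' | h'
      · exact mem_union_left _ (mem_filter.2 ⟨mem_product.2 h, h'⟩)
      · exact mem_union_right _ (mem_image.2
          ⟨(j, i), mem_filter.2 ⟨mem_product.2 h.symm, h'⟩, rfl⟩)
    have h2 := (card_le_card h1).trans (card_union_le _ _)
    rw [card_product] at h2
    have h3 : #(Q.image Prod.swap) ≤ #Q := card_image_le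
    nlinarith
  have hQT : #Q ≤ M * #(S + S - S) := by
    refine card_le_mul_card_image_of_maps_to (f := fun p : ℝ × ℝ => p.1 + f p.2 - p.2) ?_ M ?_
    · rintro ⟨i, j⟩ h
      obtain ⟨hi, hj⟩ := mem_product.1 (mem_filter.1 h).1
      exact sub_mem_sub (add_mem_add (hf' i hi).1 (hf' j hj).2.1) (hf' j hj).1
    · intro v _
      rcases (Q.filter fun p : ℝ × ℝ => p.1 + f p.2 - p.2 = v).eq_empty_or_nonempty with h | h
      · rw [h]; simp
      obtain ⟨⟨i, j⟩, hij⟩ := h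
      have key : ∀ p ∈ (Q.filter fun p : ℝ × ℝ => p.1 + f p.2 - p.2 = v),
          p.1 = i ∧ f p.2 - p.2 = f j - j := by
        rintro ⟨k, l⟩ hkl
        simp only [hQ, mem_filter, mem_product] at hij hkl
        obtain ⟨hiS, _, hi1, hi2⟩ := hf' i hij.1.1.1
        obtain ⟨_, _, hj1, _⟩ := hf' j hij.1.1.2
        obtain ⟨hkS, _, hk1, hk2⟩ := hf' k hkl.1.1.1
        obtain ⟨_, _, hl1, _⟩ := hf' l hkl.1.1.2
        have hki : k = i := by
          rcases lt_trichotomy k i with h | h | h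
          · have := hk2 i hiS h
            linarith [hij.1.2, hkl.1.2]
          · exact h
          · have := hi2 k hkS h
            linarith [hij.1.2, hkl.1.2]
        refine ⟨hki, ?_⟩
        dsimp only
        linarith [hij.2, hkl.2]
      have hj : j ∈ S₀ := (mem_product.1 (mem_filter.1 (mem_filter.1 hij).1).1).2
      refine le_trans ?_ (hmax j hj)
      refine card_le_card_of_injOn Prod.snd ?_ ?_
      · intro p hp
        have hp' : p ∈ S₀ ×ˢ S₀ := (mem_filter.1 (mem_filter.1 hp).1).1
        exact mem_filter.2 ⟨(mem_product.1 hp').2, (key p hp).2⟩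
      · intro p hp q hq hpq
        exact Prod.ext ((key p hp).1.trans (key q hq).1.symm) hpq
  calc (#S - 1) ^ 2 ≤ #S₀ ^ 2 := Nat.pow_le_pow_left (by omega) 2
    _ ≤ 2 * #Q := hQcard
    _ ≤ _ := Nat.mul_le_mul_left 2 hQT

lemma slope_squeeze {d e x y : ℝ} (hd : 0 < d) (he : 0 < e) (hx : 0 < x) (hxy : x < y) :
    (x + e + d) / (x + e) < (x + e + d) / (x + e) * ((y + d) * (y + e) / (y * (y + e + d))) ∧
    (x + e + d) / (x + e) * ((y + d) * (y + e) / (y * (y + e + d))) < (x + d) / x := by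
  have hy : 0 < y := hx.trans hxy
  constructor
  · apply lt_mul_of_one_lt_right (by positivity)
    rw [one_lt_div (by positivity)]
    nlinarith [mul_pos hd he]
  · rw [div_mul_div_comm, div_lt_div_iff₀ (by positivity) (by positivity)]
    have h1 : (y + d) * (y + e) = y * (y + e + d) + d * e := by ring
    have h2 : (x + d) * (x + e) = x * (x + e + d) + d * e := by ring
    have h3 : x * (x + e + d) < y * (y + e + d) := by
      apply mul_lt_mul'' hxy (by linarith) hx.le (by positivity)
    have h4 : 0 < d * e := mul_pos hd he
    nlinarith [mul_lt_mul_of_pos_left h3 h4]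

lemma gap_ratio_strictAnti {d e x y : ℝ} (hd : 0 < d) (he : 0 < e) (hx : 0 < x) (hxy : x < y) :
    (y + d) * (y + e) / (y * (y + e + d)) < (x + d) * (x + e) / (x * (x + e + d)) := by
  have hy : 0 < y := hx.trans hxy
  rw [div_lt_div_iff₀ (by positivity) (by positivity)]
  have h1 : (y + d) * (y + e) = y * (y + e + d) + d * e := by ring
  have h2 : (x + d) * (x + e) = x * (x + e + d) + d * e := by ring
  have h3 : x * (x + e + d) < y * (y + e + d) := by
    apply mul_lt_mul'' hxy (by linarith) hx.le (by positivity)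
  have h4 : 0 < d * e := mul_pos hd he
  rw [h1, h2]
  nlinarith [mul_lt_mul_of_pos_left h3 h4]

/-- If `P₁` consists of starts of gaps of length `d` in `P`, and `P₂` of starts of gaps of length `e`
in `P₁`, then `P` has cubically many (in `#P₂`) ratios of fourfold and threefold products. -/
lemma cube_le_card_of_gaps {P P₁ P₂ : Finset ℝ} (hpos : ∀ a ∈ P, 0 < a) {d e : ℝ} (hd : 0 < d)
    (he : 0 < e) (h₁ : P₁ ⊆ P) (hg₁ : ∀ a ∈ P₁, a + d ∈ P ∧ ∀ b ∈ P, a < b → a + d ≤ b)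
    (h₂ : P₂ ⊆ P₁) (hg₂ : ∀ a ∈ P₂, a + e ∈ P₁ ∧ ∀ b ∈ P₁, a < b → a + e ≤ b)
    {k : ℕ} (hk : 3 * k ≤ #P₂) :
    k ^ 3 ≤ #(4 • P.image Real.log - 3 • P.image Real.log) := by
  set R : ℝ × ℝ × ℝ → ℝ := fun p => p.1 * ((p.2.1 + e + d) / (p.2.1 + e) *
    ((p.2.2 + d) * (p.2.2 + e) / (p.2.2 * (p.2.2 + e + d)))) with hR
  set s := P₂.orderEmbOfFin rfl
  have hs : ∀ i, s i ∈ P₂ := fun i => orderEmbOfFin_mem _ _ i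
  set g : Fin k × Fin k × Fin k → ℝ × ℝ × ℝ := fun q =>
    (s ⟨q.1, by omega⟩, s ⟨k + q.2.1, by omega⟩, s ⟨2 * k + q.2.2, by omega⟩) with hg
  have hginj : Function.Injective g := by
    rintro ⟨a, b, c⟩ ⟨a', b', c'⟩ h
    simp only [hg, Prod.mk.injEq, EmbeddingLike.apply_eq_iff_eq, Fin.mk.injEq] at h
    ext <;> simp <;> omega
  have hgmem : ∀ q, (g q).1 ∈ P₂ ∧ (g q).2.1 ∈ P₂ ∧ (g q).2.2 ∈ P₂ ∧
      (g q).1 < (g q).2.1 ∧ (g q).2.1 < (g q).2.2 := by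
    rintro ⟨a, b, c⟩
    refine ⟨hs _, hs _, hs _, s.strictMono ?_, s.strictMono ?_⟩ <;>
      simp only [Fin.lt_def] <;> omega
  have hpos₂ : ∀ a ∈ P₂, 0 < a := fun a ha => hpos a (h₁ (h₂ ha))
  have hRpos : ∀ q, 0 < R (g q) := by
    intro q
    obtain ⟨ha, hx, hy, _⟩ := hgmem q
    have := hpos₂ _ ha
    have := hpos₂ _ hx
    have := hpos₂ _ hy
    simp only [hR]
    positivity
  have hRinj : Function.Injective (R ∘ g) := by
    intro q q' h
    apply hginj
    obtain ⟨ha, hx, hy, hax, hxy⟩ := hgmem q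
    obtain ⟨ha', hx', hy', hax', hxy'⟩ := hgmem q'
    simp only [Function.comp, hR] at h
    generalize g q = p at *
    generalize g q' = p' at *
    obtain ⟨a, x, y⟩ := p
    obtain ⟨a', x', y'⟩ := p'
    dsimp only at *
    have pa := hpos₂ _ ha
    have px := hpos₂ _ hx
    have py := hpos₂ _ hy
    have pa' := hpos₂ _ ha'
    have px' := hpos₂ _ hx'
    have py' := hpos₂ _ hy'
    have aux : ∀ {a x y : ℝ}, 0 < a → a < x → x < y →
        a < a * ((x + e + d) / (x + e) * ((y + d) * (y + e) / (y * (y + e + d)))) ∧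
        a * ((x + e + d) / (x + e) * ((y + d) * (y + e) / (y * (y + e + d)))) < a + d := by
      intro a x y ha hax hxy
      have hx := ha.trans hax
      obtain ⟨h1, h2⟩ := slope_squeeze hd he hx hxy
      constructor
      · apply lt_mul_of_one_lt_right ha
        refine lt_trans ?_ h1
        rw [one_lt_div (by positivity)]
        linarith
      · have h3 : (x + d) / x < (a + d) / a := by
          rw [div_lt_div_iff₀ hx ha]
          nlinarith
        calc _ < a * ((a + d) / a) := by gcongr; exact h2.trans h3
          _ = a + d := by field_simp
    obtain ⟨l1, u1⟩ := aux pa hax hxy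
    obtain ⟨l2, u2⟩ := aux pa' hax' hxy'
    have haa : a = a' := by
      rcases lt_trichotomy a a' with hlt | heq | hlt
      · have := (hg₁ a (h₂ ha)).2 a' (h₁ (h₂ ha')) hlt
        linarith
      · exact heq
      · have := (hg₁ a' (h₂ ha')).2 a (h₁ (h₂ ha)) hlt
        linarith
    subst haa
    have h' := mul_left_cancel₀ pa.ne' h
    have mono : ∀ {x x' : ℝ}, 0 < x → x ≤ x' → (x' + d) / x' ≤ (x + d) / x := by
      intro x x' hx hxx
      rw [div_le_div_iff₀ (hx.trans_le hxx) hx]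
      nlinarith
    obtain ⟨l1, u1⟩ := slope_squeeze hd he px hxy
    obtain ⟨l2, u2⟩ := slope_squeeze hd he px' hxy'
    have hxx : x = x' := by
      rcases lt_trichotomy x x' with hlt | heq | hlt
      · have := mono (by positivity) ((hg₂ x hx).2 x' (h₂ hx') hlt)
        linarith
      · exact heq
      · have := mono (by positivity) ((hg₂ x' hx').2 x (h₂ hx) hlt)
        linarith
    subst hxx
    have h'' := mul_left_cancel₀ (by positivity) h'
    have hyy : y = y' := by
      rcases lt_trichotomy y y' with hlt | heq | hlt
      · have := gap_ratio_strictAnti hd he py hlt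
        linarith
      · exact heq
      · have := gap_ratio_strictAnti hd he py' hlt
        linarith
    rw [hyy]
  have hlog : ∀ q ∈ (univ : Finset (Fin k × Fin k × Fin k)),
      Real.log (R (g q)) ∈ 4 • P.image Real.log - 3 • P.image Real.log := by
    intro q _
    obtain ⟨ha, hx, hy, hax, hxy⟩ := hgmem q
    simp only [hR]
    generalize g q = p at *
    obtain ⟨a, x, y⟩ := p
    dsimp only at *
    have pa := hpos₂ _ ha
    have px := hpos₂ _ hx
    have py := hpos₂ _ hy
    have hexp : Real.log (a * ((x + e + d) / (x + e) * ((y + d) * (y + e) / (y * (y + e + d)))))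
        = (Real.log a + Real.log (x + e + d) + Real.log (y + d) + Real.log (y + e)) -
          (Real.log (x + e) + Real.log y + Real.log (y + e + d)) := by
      rw [Real.log_mul (by positivity) (by positivity), Real.log_mul (by positivity) (by positivity),
        Real.log_div (by positivity) (by positivity), Real.log_div (by positivity) (by positivity),
        Real.log_mul (by positivity) (by positivity), Real.log_mul (by positivity) (by positivity)]
      ring
    have mem : ∀ {z : ℝ}, z ∈ P → Real.log z ∈ P.image Real.log := fun hz => mem_image_of_mem _ hz
    rw [hexp]
    have hxe := (hg₂ x hx).1
    have hye := (hg₂ y hy).1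
    have e4 : 4 • P.image Real.log = P.image Real.log + P.image Real.log + P.image Real.log +
        P.image Real.log := by simp only [succ_nsmul, zero_nsmul, zero_add]
    have e3 : 3 • P.image Real.log = P.image Real.log + P.image Real.log + P.image Real.log := by
      simp only [succ_nsmul, zero_nsmul, zero_add]
    rw [e4, e3]
    exact sub_mem_sub (add_mem_add (add_mem_add (add_mem_add (mem (h₁ (h₂ ha)))
      (mem (hg₁ _ hxe).1)) (mem (hg₁ _ (h₂ hy)).1)) (mem (h₁ hye)))
      (add_mem_add (add_mem_add (mem (h₁ hxe)) (mem (h₁ (h₂ hy)))) (mem (hg₁ _ hye).1))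
  have hfin := card_le_card_of_injOn (s := univ) _ hlog (by
    intro q _ q' _ h
    exact hRinj (Real.log_injOn_pos (hRpos q) (hRpos q') h))
  simp only [card_univ, Fintype.card_prod, Fintype.card_fin] at hfin
  calc k ^ 3 = k * (k * k) := by ring
    _ ≤ _ := hfin

/-- Sums of points on consecutive lines through the origin are distinct. -/
lemma card_popular_slopes_mul_sq_le {P Λ : Finset ℝ} {τ : ℕ}
    (hpos : ∀ a ∈ P, 0 < a) (hΛ : ∀ l ∈ Λ, τ ≤ #(P.filter fun a => l * a ∈ P)) :
    (#Λ - 1) * τ ^ 2 ≤ #(P + P) ^ 2 := by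
  obtain ⟨f, hf⟩ := exists_next Λ
  set Λ₀ := Λ.filter fun a => ∃ x ∈ Λ, a < x with hΛ₀
  have hcard : #Λ ≤ #Λ₀ + 1 := card_le_card_filter_exists_lt_add_one Λ
  set r : ℝ → Finset ℝ := fun l => P.filter fun a => l * a ∈ P with hr
  have hf' : ∀ a ∈ Λ₀, a ∈ Λ ∧ f a ∈ Λ ∧ a < f a ∧ ∀ b ∈ Λ, a < b → f a ≤ b := fun a ha =>
    ⟨(mem_filter.1 ha).1, hf a (mem_filter.1 ha).2⟩
  have hle : #(Λ₀.sigma fun l => r l ×ˢ r (f l)) ≤ #((P + P) ×ˢ (P + P)) := by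
    refine card_le_card_of_injOn
      (fun p => (p.2.1 + p.2.2, p.1 * p.2.1 + f p.1 * p.2.2)) ?_ ?_
    · rintro ⟨l, a, b⟩ h
      simp only [coe_sigma, Set.mem_sigma_iff, mem_coe, mem_product, hr, mem_filter] at h
      exact mem_product.2 ⟨add_mem_add h.2.1.1 h.2.2.1, add_mem_add h.2.1.2 h.2.2.2⟩
    · rintro ⟨l, a, b⟩ h ⟨l', a', b'⟩ h' heq
      simp only [coe_sigma, Set.mem_sigma_iff, mem_coe, mem_product, hr, mem_filter] at h h'
      simp only [Prod.mk.injEq] at heq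
      obtain ⟨e1, e2⟩ := heq
      have pa := hpos _ h.2.1.1
      have pb := hpos _ h.2.2.1
      have pa' := hpos _ h'.2.1.1
      have pb' := hpos _ h'.2.2.1
      obtain ⟨hl, hfl, hlt, hmin⟩ := hf' l h.1
      obtain ⟨hl', hfl', hlt', hmin'⟩ := hf' l' h'.1
      have hll : l = l' := by
        rcases lt_trichotomy l l' with hc | hc | hc
        · have h1 := hmin l' hl' hc
          have e3 : f l * (a + b) = f l * (a' + b') := by rw [e1]
          nlinarith [mul_pos (sub_pos.2 hlt) pa, mul_pos (sub_pos.2 hlt') pb',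
            mul_nonneg (sub_nonneg.2 h1) (add_pos pa' pb').le]
        · exact hc
        · have h1 := hmin' l hl hc
          have e3 : f l' * (a + b) = f l' * (a' + b') := by rw [e1]
          nlinarith [mul_pos (sub_pos.2 hlt') pa', mul_pos (sub_pos.2 hlt) pb,
            mul_nonneg (sub_nonneg.2 h1) (add_pos pa pb).le]
      subst hll
      have hbb : b = b' := by
        have : (f l - l) * (b - b') = 0 := by linear_combination e2 - l * e1
        rcases mul_eq_zero.1 this with h0 | h0
        · linarith
        · linarith
      have haa : a = a' := by linarith
      rw [hbb, haa]
  rw [card_sigma, card_product] at hle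
  calc (#Λ - 1) * τ ^ 2 ≤ #Λ₀ * τ ^ 2 := Nat.mul_le_mul_right _ (by omega)
    _ = ∑ l ∈ Λ₀, τ ^ 2 := by simp
    _ ≤ ∑ l ∈ Λ₀, #(r l ×ˢ r (f l)) := by
        refine sum_le_sum fun l hl => ?_
        rw [card_product, sq]
        exact Nat.mul_le_mul (hΛ l (hf' l hl).1) (hΛ _ (hf' l hl).2.1)
    _ ≤ _ := by rw [sq]; exact hle

lemma mulEnergy_le_sum_sq {P : Finset ℝ} (hpos : ∀ a ∈ P, 0 < a) :
    mulEnergy P P ≤ ∑ l ∈ P / P, #(P.filter fun a => l * a ∈ P) ^ 2 := by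
  unfold mulEnergy
  rw [card_eq_sum_card_fiberwise (f := fun x => x.1.2 / x.1.1) (t := P / P)]
  · refine sum_le_sum fun l _ => ?_
    rw [sq, ← card_product]
    refine card_le_card_of_injOn (fun x => (x.1.1, x.2.2)) ?_ ?_
    · rintro ⟨⟨a, b⟩, c, d⟩ h
      simp only [coe_filter, mem_filter, mem_product, Set.mem_ofPred_eq] at h
      obtain ⟨⟨⟨⟨ha, hb⟩, hc, hd⟩, h1⟩, h2⟩ := h
      have pa := hpos a ha
      have e1 : l * a = b := by rw [← h2]; field_simp
      have e2 : l * d = c := by rw [← h2]; field_simp; linarith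
      simp only [coe_product, coe_filter, Set.mem_prod, Set.mem_ofPred_eq, e1, e2]
      exact ⟨⟨ha, hb⟩, hd, hc⟩
    · rintro ⟨⟨a, b⟩, c, d⟩ h ⟨⟨a', b'⟩, c', d'⟩ h' heq
      simp only [coe_filter, mem_filter, mem_product, Set.mem_ofPred_eq] at h h'
      simp only [Prod.mk.injEq] at heq
      obtain ⟨rfl, rfl⟩ := heq
      obtain ⟨⟨⟨⟨ha, hb⟩, hc, hd⟩, h1⟩, h2⟩ := h
      obtain ⟨⟨⟨⟨_, hb'⟩, hc', _⟩, h1'⟩, h2'⟩ := h'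
      have pa := hpos a ha
      have hbb : b = b' := by
        rw [← h2'] at h2
        field_simp at h2
        exact h2
      have hcc : c = c' := by
        subst hbb
        exact mul_left_cancel₀ pa.ne' (h1.trans h1'.symm)
      rw [hbb, hcc]
  · rintro ⟨⟨a, b⟩, c, d⟩ h
    simp only [coe_filter, mem_product, Set.mem_ofPred_eq] at h
    exact div_mem_div h.1.1.2 h.1.1.1

/-- Solymosi's bound for the multiplicative energy in terms of the sumset. -/
lemma mulEnergy_le_sq_card_add {P : Finset ℝ} (hpos : ∀ a ∈ P, 0 < a) :
    (mulEnergy P P : ℝ) ≤ 4 * (#(P + P) : ℝ) ^ 2 * (1 + Real.log #P) := by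
  set r : ℝ → ℕ := fun l => #(P.filter fun a => l * a ∈ P) with hr
  rcases P.eq_empty_or_nonempty with rfl | hne
  · simp
  have hPS : #P ≤ #(P + P) := card_le_card_add_right hne
  have hlevel : ∀ τ ∈ Icc 1 #P,
      ((#((P / P).filter fun l => τ ≤ r l) : ℝ) * (2 * τ)) ≤
        4 * (#(P + P) : ℝ) ^ 2 * (τ : ℝ)⁻¹ := by
    intro τ hτ
    rw [mem_Icc] at hτ
    have h1 := card_popular_slopes_mul_sq_le (Λ := (P / P).filter fun l => τ ≤ r l) hpos
      (fun l hl => (mem_filter.1 hl).2)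
    set n := #((P / P).filter fun l => τ ≤ r l)
    have h2 : n * τ ^ 2 ≤ 2 * #(P + P) ^ 2 := by
      calc n * τ ^ 2 ≤ ((n - 1) + 1) * τ ^ 2 := Nat.mul_le_mul_right _ (by omega)
        _ = (n - 1) * τ ^ 2 + τ ^ 2 := by ring
        _ ≤ #(P + P) ^ 2 + #(P + P) ^ 2 :=
          Nat.add_le_add h1 (Nat.pow_le_pow_left (hτ.2.trans hPS) 2)
        _ = _ := by ring
    have h3 : (n : ℝ) * τ ^ 2 ≤ 2 * (#(P + P) : ℝ) ^ 2 := by exact_mod_cast h2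
    have h4 : (0 : ℝ) < τ := by exact_mod_cast hτ.1
    rw [← div_eq_mul_inv, le_div_iff₀ h4]
    nlinarith
  have hsq : ∀ m ≤ #P, ((m : ℝ) ^ 2) ≤ ∑ τ ∈ Icc 1 #P, if τ ≤ m then (2 * τ : ℝ) else 0 := by
    intro m hm
    rw [← sum_filter]
    have : (Icc 1 #P).filter (· ≤ m) = Icc 1 m := by
      ext τ
      simp only [mem_filter, mem_Icc]
      omega
    rw [this]
    clear this hm
    induction m with
    | zero => simp
    | succ m ih =>
      rw [sum_Icc_succ_top (by omega)]
      push_cast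
      nlinarith
  have hharm : ∑ τ ∈ Icc 1 #P, (τ : ℝ)⁻¹ ≤ 1 + Real.log #P := by
    have h := harmonic_le_one_add_log #P
    rw [harmonic_eq_sum_Icc] at h
    push_cast at h
    exact h
  calc (mulEnergy P P : ℝ) ≤ ∑ l ∈ P / P, (r l : ℝ) ^ 2 := by
        exact_mod_cast mulEnergy_le_sum_sq hpos
    _ ≤ ∑ l ∈ P / P, ∑ τ ∈ Icc 1 #P, if τ ≤ r l then (2 * τ : ℝ) else 0 :=
        sum_le_sum fun l _ => hsq _ (card_filter_le _ _)
    _ = ∑ τ ∈ Icc 1 #P, (#((P / P).filter fun l => τ ≤ r l) : ℝ) * (2 * τ) := by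
        rw [sum_comm]
        refine sum_congr rfl fun τ _ => ?_
        rw [← sum_filter, sum_const, nsmul_eq_mul]
    _ ≤ ∑ τ ∈ Icc 1 #P, 4 * (#(P + P) : ℝ) ^ 2 * (τ : ℝ)⁻¹ := sum_le_sum hlevel
    _ = 4 * (#(P + P) : ℝ) ^ 2 * ∑ τ ∈ Icc 1 #P, (τ : ℝ)⁻¹ := by rw [mul_sum]
    _ ≤ _ := by gcongr

lemma image_log_mul {X Y : Finset ℝ} (hX : ∀ a ∈ X, 0 < a) (hY : ∀ a ∈ Y, 0 < a) :
    (X * Y).image Real.log = X.image Real.log + Y.image Real.log := by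
  ext z
  simp only [mem_image, mem_mul, mem_add]
  constructor
  · rintro ⟨_, ⟨x, hx, y, hy, rfl⟩, rfl⟩
    exact ⟨_, ⟨x, hx, rfl⟩, _, ⟨y, hy, rfl⟩, (Real.log_mul (hX x hx).ne' (hY y hy).ne').symm⟩
  · rintro ⟨_, ⟨x, hx, rfl⟩, _, ⟨y, hy, rfl⟩, rfl⟩
    exact ⟨_, ⟨x, hx, y, hy, rfl⟩, Real.log_mul (hX x hx).ne' (hY y hy).ne'⟩

lemma card_image_log {X : Finset ℝ} (hX : ∀ a ∈ X, 0 < a) : #(X.image Real.log) = #X :=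
  card_image_of_injOn fun _ ha _ hb h => Real.log_injOn_pos (hX _ ha) (hX _ hb) h

lemma mul_pos_of_mem_mul {X Y : Finset ℝ} (hX : ∀ a ∈ X, 0 < a) (hY : ∀ a ∈ Y, 0 < a) :
    ∀ a ∈ X * Y, 0 < a := by
  intro a ha
  obtain ⟨x, hx, y, hy, rfl⟩ := mem_mul.1 ha
  exact mul_pos (hX x hx) (hY y hy)

lemma card_log_sub_mul_le {P : Finset ℝ} (hpos : ∀ a ∈ P, 0 < a) (hne : P.Nonempty) :
    #(4 • P.image Real.log - 3 • P.image Real.log) * #(P * P) ^ 6 ≤ #(P * P * P) ^ 7 := by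
  have hPP := mul_pos_of_mem_mul hpos hpos
  have hne' : ((P * P).image Real.log).Nonempty := (hne.mul hne).image _
  have h := pluennecke_ruzsa_inequality_nsmul_sub_nsmul_add hne' (P.image Real.log) 4 3
  rw [← image_log_mul hPP hpos, card_image_log hPP,
    card_image_log (mul_pos_of_mem_mul hPP hpos)] at h
  have h0 : (0 : ℚ≥0) < #(P * P) := by exact_mod_cast (hne.mul hne).card_pos
  have h1 : (#(P * P * P) / #(P * P) : ℚ≥0) ^ (4 + 3) * #(P * P) * #(P * P) ^ 6
      = #(P * P * P) ^ 7 := by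
    rw [div_pow]
    field_simp
    ring
  have h2 := mul_le_mul_left h ((#(P * P) : ℚ≥0) ^ 6)
  rw [h1] at h2
  exact_mod_cast h2

lemma card_add_sub_mul_sq_le {P : Finset ℝ} (hne : P.Nonempty) :
    #(P + P - P) * #P ^ 2 ≤ #(P + P) ^ 3 := by
  have h := pluennecke_ruzsa_inequality_nsmul_sub_nsmul_add hne P 2 1
  rw [two_nsmul, one_nsmul] at h
  have h0 : (0 : ℚ≥0) < #P := by exact_mod_cast hne.card_pos
  have h1 : (#(P + P) / #P : ℚ≥0) ^ (2 + 1) * #P * #P ^ 2 = #(P + P) ^ 3 := by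
    rw [div_pow]
    field_simp
    ring
  have h2 := mul_le_mul_left h ((#P : ℚ≥0) ^ 2)
  rw [h1] at h2
  exact_mod_cast h2

lemma exists_pos_finset (A : Finset ℝ) : ∃ P : Finset ℝ, (∀ a ∈ P, 0 < a) ∧ #A ≤ 2 * #P + 1 ∧
    #P ≤ #A ∧ #(P + P) ≤ #(A + A) ∧ #(P * P * P) ≤ #(A * A * A) := by
  have hcard : #A ≤ #(A.filter (0 < ·)) + #(A.filter (· < 0)) + 1 := by
    have h : A ⊆ A.filter (0 < ·) ∪ A.filter (· < 0) ∪ {0} := by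
      intro a ha
      rcases lt_trichotomy a 0 with h | h | h <;> simp [ha, h]
    exact (card_le_card h).trans ((card_union_le _ _).trans
      (Nat.add_le_add (card_union_le _ _) (by simp)))
  rcases le_total #(A.filter (· < 0)) #(A.filter (0 < ·)) with h | h
  · have hs : A.filter (0 < ·) ⊆ A := filter_subset _ _
    exact ⟨A.filter (0 < ·), fun a ha => (mem_filter.1 ha).2, by omega, card_le_card hs,
      card_le_card (add_subset_add hs hs),
      card_le_card (mul_subset_mul (mul_subset_mul hs hs) hs)⟩
  · have hs : A.filter (· < 0) ⊆ A := filter_subset _ _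
    refine ⟨-A.filter (· < 0), fun a ha => ?_, ?_, ?_, ?_, ?_⟩
    · rw [mem_neg'] at ha
      linarith [(mem_filter.1 ha).2]
    · rw [card_neg]; omega
    · rw [card_neg]; exact card_le_card hs
    · rw [← neg_add, card_neg]
      exact card_le_card (add_subset_add hs hs)
    · rw [neg_mul_neg, mul_neg, card_neg]
      exact card_le_card (mul_subset_mul (mul_subset_mul hs hs) hs)

lemma le_of_pow_mul_le {t x : ℝ} (ht : 0 < t) {i j l : ℕ} (hl : l = j + i)
    (h : x * t ^ i ≤ t ^ l) : x ≤ t ^ j := by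
  rw [hl, pow_add] at h
  exact le_of_mul_le_mul_right h (pow_pos ht i)

lemma pow_le_of_le_mul_pow {t x : ℝ} (ht : 0 < t) {i j l : ℕ} (hl : l = j + i)
    (h : t ^ l ≤ x * t ^ i) : t ^ j ≤ x := by
  rw [hl, pow_add] at h
  exact le_of_mul_le_mul_right h (pow_pos ht i)

lemma thousand_mul_pow_le {t : ℝ} (ht : 1000 ≤ t) {i j : ℕ} (hj : j = i + 1) :
    1000 * t ^ i ≤ t ^ j := by
  rw [hj, pow_succ']
  gcongr

/-- Lower bound for the differences of iterated product sets, in terms of a scale `t`. -/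
lemma pow_le_card_log_sub {P : Finset ℝ} (hpos : ∀ a ∈ P, 0 < a) {t : ℝ} (ht : 1000 ≤ t)
    (hP : t ^ 199 + 1 ≤ #P) (hS : (#(P + P) : ℝ) ≤ t ^ 201) :
    t ^ 531 ≤ (#(4 • P.image Real.log - 3 • P.image Real.log) : ℝ) := by
  have t0 : (0 : ℝ) < t := by linarith
  have one_le : ∀ i : ℕ, (1 : ℝ) ≤ t ^ i := fun i => one_le_pow₀ (by linarith)
  have hP1 : t ^ 199 ≤ (#P : ℝ) := by linarith
  have hP2 : 2 ≤ #P := by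
    have : (2 : ℝ) ≤ #P := by linarith [one_le 199]
    exact_mod_cast this
  have hne : P.Nonempty := card_pos.1 (by omega)
  have hT : (#(P + P - P) : ℝ) ≤ t ^ 205 := by
    have h : (#(P + P - P) : ℝ) * (#P : ℝ) ^ 2 ≤ (#(P + P) : ℝ) ^ 3 := by
      exact_mod_cast card_add_sub_mul_sq_le hne
    refine le_of_pow_mul_le t0 (i := 398) (l := 603) rfl ?_
    calc (#(P + P - P) : ℝ) * t ^ 398 = #(P + P - P) * (t ^ 199) ^ 2 := by rw [← pow_mul]
      _ ≤ #(P + P - P) * (#P : ℝ) ^ 2 := by gcongr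
      _ ≤ (#(P + P) : ℝ) ^ 3 := h
      _ ≤ (t ^ 201) ^ 3 := by gcongr
      _ = t ^ 603 := by rw [← pow_mul]
  obtain ⟨d, hd, P₁, h₁, hg₁, hc₁⟩ := exists_popular_gap P hP2
  have hP₁ : t ^ 192 + 1 ≤ #P₁ := by
    have h : ((#P : ℝ) - 1) ^ 2 ≤ 2 * (#P₁ * #(P + P - P)) := by
      have := (Nat.cast_le (α := ℝ)).2 hc₁
      push_cast [Nat.cast_sub (show 1 ≤ #P by omega)] at this
      exact this
    have h' : t ^ 193 ≤ 2 * (#P₁ : ℝ) := by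
      refine pow_le_of_le_mul_pow t0 (i := 205) (l := 398) rfl ?_
      calc t ^ 398 = (t ^ 199) ^ 2 := by rw [← pow_mul]
        _ ≤ ((#P : ℝ) - 1) ^ 2 := by gcongr; linarith
        _ ≤ 2 * (#P₁ * #(P + P - P)) := h
        _ ≤ 2 * (#P₁ * t ^ 205) := by gcongr
        _ = _ := by rw [mul_assoc]
    linarith [thousand_mul_pow_le ht (i := 192) (j := 193) rfl, one_le 192]
  have hP₁2 : 2 ≤ #P₁ := by
    have : (2 : ℝ) ≤ #P₁ := by linarith [one_le 192]
    exact_mod_cast this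
  obtain ⟨e, he, P₂, h₂, hg₂, hc₂⟩ := exists_popular_gap P₁ hP₁2
  have hP₂ : t ^ 178 ≤ #P₂ := by
    have h : ((#P₁ : ℝ) - 1) ^ 2 ≤ 2 * (#P₂ * #(P₁ + P₁ - P₁)) := by
      have := (Nat.cast_le (α := ℝ)).2 hc₂
      push_cast [Nat.cast_sub (show 1 ≤ #P₁ by omega)] at this
      exact this
    have hT₁ : (#(P₁ + P₁ - P₁) : ℝ) ≤ t ^ 205 := by
      refine le_trans ?_ hT
      exact_mod_cast card_le_card (sub_subset_sub (add_subset_add h₁ h₁) h₁)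
    have h' : t ^ 179 ≤ 2 * (#P₂ : ℝ) := by
      refine pow_le_of_le_mul_pow t0 (i := 205) (l := 384) rfl ?_
      calc t ^ 384 = (t ^ 192) ^ 2 := by rw [← pow_mul]
        _ ≤ ((#P₁ : ℝ) - 1) ^ 2 := by gcongr; linarith
        _ ≤ 2 * (#P₂ * #(P₁ + P₁ - P₁)) := h
        _ ≤ 2 * (#P₂ * t ^ 205) := by gcongr
        _ = _ := by rw [mul_assoc]
    linarith [thousand_mul_pow_le ht (i := 178) (j := 179) rfl, one_le 178]
  have hk : t ^ 177 ≤ ((#P₂ / 3 : ℕ) : ℝ) := by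
    have h : #P₂ ≤ 3 * (#P₂ / 3) + 2 := by omega
    have h' : (#P₂ : ℝ) ≤ 3 * ((#P₂ / 3 : ℕ) : ℝ) + 2 := by exact_mod_cast h
    linarith [thousand_mul_pow_le ht (i := 177) (j := 178) rfl, one_le 177]
  have hcube := cube_le_card_of_gaps hpos hd he h₁ hg₁ h₂ hg₂ (k := #P₂ / 3) (by omega)
  calc t ^ 531 = (t ^ 177) ^ 3 := by rw [← pow_mul]
    _ ≤ ((#P₂ / 3 : ℕ) : ℝ) ^ 3 := by gcongr
    _ ≤ _ := by exact_mod_cast hcube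

/-- Upper bound for the differences of iterated product sets, in terms of a scale `t`. -/
lemma card_log_sub_le_pow {P : Finset ℝ} (hpos : ∀ a ∈ P, 0 < a) {t : ℝ} (ht : 1000 ≤ t)
    (hP : t ^ 199 ≤ #P) (hlog : 1 + Real.log #P ≤ t) (hS : (#(P + P) : ℝ) ≤ t ^ 201)
    (hQ : (#(P * P * P) : ℝ) ≤ t ^ 401) :
    (#(4 • P.image Real.log - 3 • P.image Real.log) : ℝ) ≤ t ^ 455 := by
  have t0 : (0 : ℝ) < t := by linarith
  have hne : P.Nonempty := by
    rw [← card_pos]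
    have : (0 : ℝ) < #P := (pow_pos t0 199).trans_le hP
    exact_mod_cast this
  have hPP : t ^ 392 ≤ #(P * P) := by
    have h : ((#P : ℝ) * #P) ^ 2 ≤ #(P * P) * (mulEnergy P P : ℝ) := by
      have := le_card_mul_mul_mulEnergy P P
      rw [← mul_pow] at this
      exact_mod_cast this
    refine pow_le_of_le_mul_pow t0 (i := 404) (l := 796) rfl ?_
    calc t ^ 796 = (t ^ 199 * t ^ 199) ^ 2 := by rw [← pow_add, ← pow_mul]
      _ ≤ ((#P : ℝ) * #P) ^ 2 := by gcongr
      _ ≤ #(P * P) * (mulEnergy P P : ℝ) := h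
      _ ≤ #(P * P) * (4 * (#(P + P) : ℝ) ^ 2 * (1 + Real.log #P)) := by
          gcongr
          exact mulEnergy_le_sq_card_add hpos
      _ ≤ #(P * P) * (4 * (t ^ 201) ^ 2 * t) := by gcongr
      _ = #(P * P) * (4 * t ^ 403) := by rw [← pow_mul, mul_assoc 4, ← pow_succ]
      _ ≤ #(P * P) * t ^ 404 := by
          gcongr
          linarith [thousand_mul_pow_le ht (i := 403) (j := 404) rfl, pow_pos t0 403]
  have h : (#(4 • P.image Real.log - 3 • P.image Real.log) : ℝ) * (#(P * P) : ℝ) ^ 6 ≤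
      (#(P * P * P) : ℝ) ^ 7 := by
    exact_mod_cast card_log_sub_mul_le hpos hne
  refine le_of_pow_mul_le t0 (i := 2352) (l := 2807) rfl ?_
  calc (#(4 • P.image Real.log - 3 • P.image Real.log) : ℝ) * t ^ 2352
      = #(4 • P.image Real.log - 3 • P.image Real.log) * (t ^ 392) ^ 6 := by rw [← pow_mul]
    _ ≤ #(4 • P.image Real.log - 3 • P.image Real.log) * (#(P * P) : ℝ) ^ 6 := by gcongr
    _ ≤ (#(P * P * P) : ℝ) ^ 7 := h
    _ ≤ (t ^ 401) ^ 7 := by gcongr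
    _ = t ^ 2807 := by rw [← pow_mul]

lemma exists_threshold : ∃ N : ℕ, ∀ n : ℕ, N ≤ n →
    1000 ≤ (n : ℝ) ^ (1 / 200 : ℝ) ∧ 1 + Real.log n ≤ (n : ℝ) ^ (1 / 200 : ℝ) := by
  have h1 : ∀ᶠ x : ℝ in Filter.atTop, 1000 ≤ x ^ (1 / 200 : ℝ) :=
    (tendsto_rpow_atTop (by norm_num)).eventually_ge_atTop 1000
  have h2 : ∀ᶠ x : ℝ in Filter.atTop, ‖Real.log x‖ ≤ 1 / 2 * ‖x ^ (1 / 200 : ℝ)‖ :=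
    (isLittleO_log_rpow_atTop (by norm_num)).bound (by norm_num)
  have h3 := tendsto_natCast_atTop_atTop (R := ℝ) |>.eventually (h1.and h2)
  obtain ⟨N, hN⟩ := Filter.eventually_atTop.1 h3
  refine ⟨N, fun n hn => ?_⟩
  obtain ⟨a, b⟩ := hN n hn
  rw [Real.norm_eq_abs, Real.norm_of_nonneg (by positivity)] at b
  exact ⟨a, by linarith [le_abs_self (Real.log n)]⟩

theorem stmt_0 :
    ∃ c₁ c₂ : ℝ, 0 < c₁ ∧ 0 < c₂ ∧ ∃ N : ℕ, ∀ A : Finset ℝ,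
      N ≤ A.card →
      ((A + A).card : ℝ) ≤ (A.card : ℝ) ^ ((1 : ℝ) + c₁) →
      (A.card : ℝ) ^ ((2 : ℝ) + c₂) ≤ ((A * A * A).card : ℝ) := by
  obtain ⟨N, hN⟩ := exists_threshold
  refine ⟨1 / 200, 1 / 200, by norm_num, by norm_num, N, fun A hA hsum => ?_⟩
  obtain ⟨ht, hlog⟩ := hN _ hA
  set t := (#A : ℝ) ^ (1 / 200 : ℝ) with htdef
  have t0 : (0 : ℝ) < t := by linarith
  have hpow : ∀ (x : ℝ) (m : ℕ), x = 1 / 200 * m → (#A : ℝ) ^ x = t ^ m := by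
    intro x m hx
    rw [hx, Real.rpow_mul (Nat.cast_nonneg _), Real.rpow_natCast]
  rw [hpow (1 + 1 / 200) 201 (by norm_num)] at hsum
  rw [hpow (2 + 1 / 200) 401 (by norm_num)]
  have hA' : (#A : ℝ) = t ^ 200 := by
    rw [← hpow 1 200 (by norm_num), Real.rpow_one]
  by_contra! hprod
  obtain ⟨P, hpos, hcard, hPA, hPP, hPPP⟩ := exists_pos_finset A
  have hP : t ^ 199 + 1 ≤ #P := by
    have h : (#A : ℝ) ≤ 2 * #P + 1 := by exact_mod_cast hcard
    rw [hA'] at h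
    linarith [thousand_mul_pow_le ht (i := 199) (j := 200) rfl,
      one_le_pow₀ (n := 199) (by linarith : 1 ≤ t)]
  have hP0 : (0 : ℝ) < #P := by linarith [pow_pos t0 199]
  have hS : (#(P + P) : ℝ) ≤ t ^ 201 := le_trans (by exact_mod_cast hPP) hsum
  have hQ : (#(P * P * P) : ℝ) ≤ t ^ 401 := le_trans (by exact_mod_cast hPPP) hprod.le
  have hlogP : 1 + Real.log #P ≤ t := by
    have := Real.log_le_log hP0 (by exact_mod_cast hPA : (#P : ℝ) ≤ #A)
    linarith
  have h1 := pow_le_card_log_sub hpos ht hP hS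
  have h2 := card_log_sub_le_pow hpos ht (by linarith) hlogP hS hQ
  have h3 : t ^ 455 < t ^ 531 := pow_lt_pow_right₀ (by linarith) (by norm_num)
  linarith
end

section
/- There exists an absolute constant C > 0 such that for every finite set A ⊆ ℝ with |A| ≥ 2 and every real M ≥ 1 satisfying |AA| ≤ M|A|, the additive energy satisfies E⁺(A) ≤ C · M^(8/5) · |A|^(49/20) · (log |A|)^(1/5). -/
open Finset Pointwise

/-- The number of representations of `w` as a difference `a - b` with `a ∈ A`, `b ∈ B`. -/
noncomputable def diffRep (A B : Finset ℝ) (w : ℝ) : ℕ := #{z ∈ A ×ˢ B | z.1 - z.2 = w}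

/-- Splitting a finite set of reals into consecutive blocks of size at most `d`. -/
lemma exists_monotone_block (S : Finset ℝ) {d : ℕ} (hd : 0 < d) :
    ∃ c : ℝ → ℕ, Monotone c ∧ (∀ x, c x ≤ #S / d) ∧ ∀ i, #{x ∈ S | c x = i} ≤ d := by
  classical
  have hmono : Monotone fun x : ℝ => #{y ∈ S | y < x} := by
    intro x x' h
    refine card_le_card fun y hy => ?_
    simp only [mem_filter] at hy ⊢
    exact ⟨hy.1, hy.2.trans_le h⟩
  refine ⟨fun x => #{y ∈ S | y < x} / d, fun x x' h => Nat.div_le_div_right (hmono h),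
    fun x => Nat.div_le_div_right (card_filter_le _ _), fun i => ?_⟩
  have hinj : Set.InjOn (fun x : ℝ => #{y ∈ S | y < x}) {x ∈ S | #{y ∈ S | y < x} / d = i} := by
    have key : ∀ x ∈ S, ∀ x', x < x' → #{y ∈ S | y < x} < #{y ∈ S | y < x'} := by
      intro x hx x' h
      refine card_lt_card ⟨fun y hy => ?_, fun hsub => ?_⟩
      · simp only [mem_filter] at hy ⊢
        exact ⟨hy.1, hy.2.trans h⟩
      · have := hsub (mem_filter.2 ⟨hx, h⟩)
        simp at this
    intro x hx x' hx' h
    simp only [Set.mem_ofPred_eq] at hx hx' h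
    rcases lt_trichotomy x x' with hlt | heq | hlt
    · exact absurd h (key x hx.1 x' hlt).ne
    · exact heq
    · exact absurd h (key x' hx'.1 x hlt).ne'
  have := card_le_card_of_injOn (s := {x ∈ S | #{y ∈ S | y < x} / d = i})
    (t := Finset.Ico (i * d) (i * d + d)) _ (fun x hx => ?_) (by simpa using hinj)
  · simpa using this
  · simp only [coe_filter, Set.mem_ofPred_eq] at hx
    have h := hx.2
    simp only [coe_Ico, Set.mem_Ico]
    rw [Nat.div_eq_iff hd] at h
    constructor <;> omega

lemma card_le_card_image_add_card_pairs {α β : Type*} [DecidableEq α] [DecidableEq β]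
    (S : Finset α) (f : α → β) :
    #S ≤ #(S.image f) + #{p ∈ S ×ˢ S | p.1 ≠ p.2 ∧ f p.1 = f p.2} := by
  rcases S.eq_empty_or_nonempty with rfl | ⟨a₀, -⟩
  · simp
  have hg : ∀ b : β, ∃ a, b ∈ S.image f → a ∈ S ∧ f a = b := by
    intro b
    by_cases hb : b ∈ S.image f
    · obtain ⟨a, ha, hab⟩ := mem_image.1 hb
      exact ⟨a, fun _ => ⟨ha, hab⟩⟩
    · exact ⟨a₀, fun h => absurd h hb⟩
  choose g hg using hg
  rw [← card_filter_add_card_filter_not (s := S) fun x => x = g (f x)]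
  refine Nat.add_le_add (card_le_card_of_injOn f ?_ ?_)
    (card_le_card_of_injOn (fun x => (x, g (f x))) ?_ ?_)
  · intro x hx
    simp only [coe_filter, Set.mem_ofPred_eq] at hx
    exact mem_image_of_mem f hx.1
  · intro x hx y hy hxy
    simp only [coe_filter, Set.mem_ofPred_eq] at hx hy
    rw [hx.2, hy.2, hxy]
  · intro x hx
    simp only [coe_filter, Set.mem_ofPred_eq] at hx
    have := hg (f x) (mem_image_of_mem f hx.1)
    simp only [coe_filter, mem_product, Set.mem_ofPred_eq]
    exact ⟨⟨hx.1, this.1⟩, hx.2, this.2.symm⟩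
  · intro x _ y _ hxy
    exact (Prod.ext_iff.1 hxy).1

lemma card_image_prodMk_le_of_monotone (S : Finset ℝ) {f h : ℝ → ℕ} (hf : Monotone f)
    (hh : Monotone h) {K₁ K₂ : ℕ} (hfK : ∀ x, f x ≤ K₁) (hhK : ∀ x, h x ≤ K₂) :
    #(S.image fun x => (f x, h x)) ≤ K₁ + K₂ + 1 := by
  have := card_le_card_of_injOn (s := S.image fun x => (f x, h x)) (t := range (K₁ + K₂ + 1))
    (fun z => z.1 + z.2) ?_ ?_
  · simpa using this
  · intro z hz
    simp only [coe_image, Set.mem_image] at hz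
    obtain ⟨x, -, rfl⟩ := hz
    have := hfK x
    have := hhK x
    simp only [coe_range, Set.mem_Iio]
    omega
  · intro z hz z' hz' heq
    simp only [coe_image, Set.mem_image] at hz hz'
    obtain ⟨x, -, rfl⟩ := hz
    obtain ⟨y, -, rfl⟩ := hz'
    simp only at heq
    rcases le_total x y with hxy | hxy
    · have := hf hxy
      have := hh hxy
      ext <;> simp only <;> omega
    · have := hf hxy
      have := hh hxy
      ext <;> simp only <;> omega

lemma card_image_prodMk_le_of_antitone (S : Finset ℝ) {f h : ℝ → ℕ} (hf : Monotone f)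
    (hh : Antitone h) {K₁ K₂ : ℕ} (hfK : ∀ x, f x ≤ K₁) (hhK : ∀ x, h x ≤ K₂) :
    #(S.image fun x => (f x, h x)) ≤ K₁ + K₂ + 1 := by
  have hmono := card_image_prodMk_le_of_monotone S hf (h := fun x => K₂ - h x)
    (fun x y hxy => Nat.sub_le_sub_left (hh hxy) _) hfK (fun x => Nat.sub_le _ _)
  refine le_trans ?_ hmono
  have : (S.image fun x => (f x, h x)) =
      (S.image fun x => (f x, K₂ - h x)).image fun z => (z.1, K₂ - z.2) := by
    rw [image_image]
    refine image_congr fun x _ => ?_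
    have := hhK x
    simp only [Function.comp_apply, Prod.mk.injEq, true_and]
    omega
  rw [this]
  exact card_image_le

lemma card_pairs_le_of_fiber_le (S : Finset ℝ) (c : ℝ → ℕ) {d : ℕ}
    (h : ∀ i, #{x ∈ S | c x = i} ≤ d) : #{p ∈ S ×ˢ S | c p.1 = c p.2} ≤ #S * d := by
  rw [card_filter, sum_product]
  calc _ ≤ ∑ x ∈ S, d := by
        refine sum_le_sum fun x _ => ?_
        rw [← card_filter]
        simpa [eq_comm] using h (c x)
    _ = _ := by simp

/-- The values of `q ∈ Q` at which the line `q ↦ l.1 * q - l.2` takes a value in `W`. -/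
noncomputable def lineHits (Q W : Finset ℝ) (l : ℝ × ℝ) : Finset ℝ := {q ∈ Q | l.1 * q - l.2 ∈ W}

lemma card_lineHits_le (Q W : Finset ℝ) {l : ℝ × ℝ} (hl : l.1 ≠ 0) {cQ cW : ℝ → ℕ}
    (hQ : Monotone cQ) (hW : Monotone cW) {K₁ K₂ : ℕ} (hQK : ∀ x, cQ x ≤ K₁)
    (hWK : ∀ x, cW x ≤ K₂) :
    #(lineHits Q W l) ≤ K₁ + K₂ + 1 + #{p ∈ lineHits Q W l ×ˢ lineHits Q W l |
      p.1 ≠ p.2 ∧ cQ p.1 = cQ p.2 ∧ cW (l.1 * p.1 - l.2) = cW (l.1 * p.2 - l.2)} := by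
  have h := card_le_card_image_add_card_pairs (lineHits Q W l)
    fun q => (cQ q, cW (l.1 * q - l.2))
  simp only [Prod.mk.injEq] at h
  refine h.trans (Nat.add_le_add_right ?_ _)
  rcases lt_or_gt_of_ne hl with hneg | hpos
  · refine card_image_prodMk_le_of_antitone _ hQ (h := fun q => cW (l.1 * q - l.2))
      (fun x y hxy => hW ?_) hQK (fun _ => hWK _)
    nlinarith
  · refine card_image_prodMk_le_of_monotone _ hQ (h := fun q => cW (l.1 * q - l.2))
      (fun x y hxy => hW ?_) hQK (fun _ => hWK _)
    nlinarith

lemma sum_card_lineHits_pairs_le (Q W P Y : Finset ℝ) (cQ cW : ℝ → ℕ) {d e : ℕ}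
    (hQ : ∀ i, #{x ∈ Q | cQ x = i} ≤ d) (hW : ∀ i, #{x ∈ W | cW x = i} ≤ e) :
    ∑ l ∈ P ×ˢ Y, #{p ∈ lineHits Q W l ×ˢ lineHits Q W l |
      p.1 ≠ p.2 ∧ cQ p.1 = cQ p.2 ∧ cW (l.1 * p.1 - l.2) = cW (l.1 * p.2 - l.2)}
      ≤ (#Q * d) * (#W * e) := by
  rw [← card_sigma]
  refine le_trans ?_ (Nat.mul_le_mul (card_pairs_le_of_fiber_le Q cQ hQ)
    (card_pairs_le_of_fiber_le W cW hW))
  rw [← card_product]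
  refine card_le_card_of_injOn
    (fun z => (z.2, (z.1.1 * z.2.1 - z.1.2, z.1.1 * z.2.2 - z.1.2))) ?_ ?_
  · rintro ⟨l, p⟩ hz
    simp only [coe_sigma, Set.mem_sigma_iff, coe_filter, mem_product, Set.mem_ofPred_eq, lineHits,
      mem_filter] at hz
    simp only [coe_product, Set.mem_prod, coe_filter, mem_product, Set.mem_ofPred_eq]
    tauto
  · rintro ⟨⟨a, b⟩, ⟨x, y⟩⟩ hz ⟨⟨a', b'⟩, ⟨x', y'⟩⟩ - heq
    simp only [Prod.mk.injEq] at heq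
    obtain ⟨⟨rfl, rfl⟩, h1, h2⟩ := heq
    simp only [coe_sigma, Set.mem_sigma_iff, coe_filter, Set.mem_ofPred_eq] at hz
    have hxy : x - y ≠ 0 := sub_ne_zero.2 hz.2.2.1
    have ha : a = a' := by
      apply mul_right_cancel₀ hxy
      linarith
    subst ha
    have hb : b = b' := by linarith
    subst hb
    rfl

/-- **Szemerédi–Trotter** for rich points on a grid: if each point of `Q × W` lies on at least `t`
of the lines `w = p q - y`, then the grid is small. -/
theorem rich_grid_bound (Q W P Y : Finset ℝ) (hQ : 0 ∉ Q) (hP : 0 ∉ P) (t : ℕ)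
    (h : ∀ q ∈ Q, ∀ w ∈ W, t ≤ #{z ∈ P ×ˢ Y | z.1 * q - z.2 = w}) :
    (#Q * #W * t ^ 3 : ℝ) ≤ 288 * (#P * #Y : ℝ) ^ 2 := by
  classical
  rcases Q.eq_empty_or_nonempty with rfl | hQn
  · simp; positivity
  rcases W.eq_empty_or_nonempty with rfl | hWn
  · simp; positivity
  rcases Nat.eq_zero_or_pos t with rfl | ht
  · simp; positivity
  have hne : ∀ l ∈ P ×ˢ Y, l.1 ≠ 0 := by
    rintro l hl h0
    exact hP (h0 ▸ (mem_product.1 hl).1)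
  have hI : #Q * #W * t ≤ ∑ l ∈ P ×ˢ Y, #(lineHits Q W l) := by
    calc #Q * #W * t = ∑ z ∈ Q ×ˢ W, t := by simp
      _ ≤ ∑ z ∈ Q ×ˢ W, #{l ∈ P ×ˢ Y | l.1 * z.1 - l.2 = z.2} :=
        sum_le_sum fun z hz => h _ (mem_product.1 hz).1 _ (mem_product.1 hz).2
      _ = ∑ l ∈ P ×ˢ Y, #{z ∈ Q ×ˢ W | l.1 * z.1 - l.2 = z.2} := by
        simp only [card_filter]
        exact sum_comm
      _ ≤ _ := by
        refine sum_le_sum fun l _ => ?_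
        refine card_le_card_of_injOn Prod.fst ?_ ?_
        · intro z hz
          simp only [coe_filter, mem_product, Set.mem_ofPred_eq, lineHits] at hz ⊢
          exact ⟨hz.1.1, hz.2 ▸ hz.1.2⟩
        · intro z hz z' hz' heq
          simp only [coe_filter, Set.mem_ofPred_eq] at hz hz'
          ext
          · exact heq
          · rw [← hz.2, ← hz'.2, heq]
  have hIQ : #Q * #W * t ≤ #P * #Y * #Q := by
    refine hI.trans ?_
    calc _ ≤ ∑ l ∈ P ×ˢ Y, #Q := sum_le_sum fun l _ => card_filter_le _ _
      _ = _ := by simp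
  have hIW : #Q * #W * t ≤ #P * #Y * #W := by
    refine hI.trans ?_
    calc _ ≤ ∑ l ∈ P ×ˢ Y, #W := sum_le_sum fun l hl => ?_
      _ = _ := by simp
    refine card_le_card_of_injOn (fun q => l.1 * q - l.2) ?_ ?_
    · intro q hq
      simp only [lineHits, coe_filter, Set.mem_ofPred_eq] at hq
      exact hq.2
    · intro q _ q' _ heq
      simp only [sub_left_inj] at heq
      exact mul_left_cancel₀ (hne l hl) heq
  have htt : t * t ≤ #P * #Y := by
    obtain ⟨q, hq⟩ := hQn
    obtain ⟨w, hw⟩ := hWn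
    have hq0 : q ≠ 0 := fun h0 => hQ (h0 ▸ hq)
    refine Nat.mul_le_mul ((h q hq w hw).trans ?_) ((h q hq w hw).trans ?_)
    · refine card_le_card_of_injOn Prod.fst ?_ ?_
      · intro z hz
        simp only [coe_filter, mem_product, Set.mem_ofPred_eq] at hz
        exact hz.1.1
      · intro z hz z' hz' heq
        simp only [coe_filter, Set.mem_ofPred_eq] at hz hz'
        ext
        · exact heq
        · have h1 := hz.2
          have h2 := hz'.2
          rw [heq] at h1
          linarith
    · refine card_le_card_of_injOn Prod.snd ?_ ?_
      · intro z hz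
        simp only [coe_filter, mem_product, Set.mem_ofPred_eq] at hz
        exact hz.1.2
      · intro z hz z' hz' heq
        simp only [coe_filter, Set.mem_ofPred_eq] at hz hz'
        ext
        · apply mul_right_cancel₀ hq0
          have h1 := hz.2
          have h2 := hz'.2
          rw [heq] at h1
          linarith
        · exact heq
  have hblock : ∀ d e : ℕ, 0 < d → 0 < e →
      #Q * #W * t ≤ #P * #Y * (#Q / d + #W / e + 1) + (#Q * d) * (#W * e) := by
    intro d e hd he
    obtain ⟨cQ, hcQ, hcQK, hcQd⟩ := exists_monotone_block Q hd
    obtain ⟨cW, hcW, hcWK, hcWe⟩ := exists_monotone_block W he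
    refine hI.trans ((sum_le_sum fun l hl =>
      card_lineHits_le Q W (hne l hl) hcQ hcW hcQK hcWK).trans ?_)
    rw [sum_add_distrib]
    refine Nat.add_le_add ?_ (sum_card_lineHits_pairs_le Q W P Y cQ cW hcQd hcWe)
    simp
  have hQ0 : (0 : ℝ) < #Q := by exact_mod_cast hQn.card_pos
  have hW0 : (0 : ℝ) < #W := by exact_mod_cast hWn.card_pos
  have ht0 : (0 : ℝ) < t := by exact_mod_cast ht
  obtain ⟨L, hL⟩ : ∃ L : ℝ, L = #P * #Y := ⟨_, rfl⟩
  have hIQ' : (#W * t : ℝ) ≤ L := by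
    have : (#Q * #W * t : ℝ) ≤ #P * #Y * #Q := by exact_mod_cast hIQ
    rw [← hL] at this
    nlinarith
  have hIW' : (#Q * t : ℝ) ≤ L := by
    have : (#Q * #W * t : ℝ) ≤ #P * #Y * #W := by exact_mod_cast hIW
    rw [← hL] at this
    nlinarith
  have htt' : (t * t : ℝ) ≤ L := by rw [hL]; exact_mod_cast htt
  have hL0 : 0 < L := by nlinarith
  rw [← hL]
  obtain ⟨ρ, hρ⟩ : ∃ ρ : ℝ, ρ = #Q * #W * t / (6 * L) := ⟨_, rfl⟩
  have hρL : ρ * (6 * L) = #Q * #W * t := by rw [hρ]; field_simp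
  have hρ0 : 0 < ρ := by rw [hρ]; positivity
  rcases lt_or_ge ρ 1 with hρ1 | hρ1
  · have : (#Q * #W * t : ℝ) ≤ 6 * L := by nlinarith
    calc (#Q * #W * t ^ 3 : ℝ) = (#Q * #W * t) * (t * t) := by ring
      _ ≤ (6 * L) * L := by gcongr
      _ ≤ _ := by nlinarith [sq_nonneg L]
  · have hρQ : ρ ≤ #Q := by
      have : ρ * (6 * L) ≤ #Q * L := by rw [hρL]; nlinarith
      nlinarith
    have hρW : ρ ≤ #W := by
      have : ρ * (6 * L) ≤ #W * L := by rw [hρL]; nlinarith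
      nlinarith
    have hsize : ∀ n : ℕ, ρ ≤ n → 0 < ⌈(n : ℝ) / ρ⌉₊ ∧ (⌈(n : ℝ) / ρ⌉₊ : ℝ) ≤ 2 * (n / ρ) ∧
        ((n / ⌈(n : ℝ) / ρ⌉₊ : ℕ) : ℝ) ≤ ρ := by
      intro n hn
      have hn0 : (0 : ℝ) < n := hρ0.trans_le hn
      have h1 : 1 ≤ (n : ℝ) / ρ := by rwa [le_div_iff₀ hρ0, one_mul]
      have h0 : 0 < ⌈(n : ℝ) / ρ⌉₊ := Nat.ceil_pos.2 (by positivity)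
      refine ⟨h0, ?_, ?_⟩
      · have := Nat.ceil_lt_add_one (show 0 ≤ (n : ℝ) / ρ by positivity)
        linarith
      · refine Nat.cast_div_le.trans ?_
        rw [div_le_iff₀ (by exact_mod_cast h0)]
        have := Nat.le_ceil ((n : ℝ) / ρ)
        rw [div_le_iff₀ hρ0] at this
        linarith
    obtain ⟨hd0, hd2, hd⟩ := hsize _ hρQ
    obtain ⟨he0, he2, he⟩ := hsize _ hρW
    have hb : (#Q * #W * t : ℝ) ≤ #P * #Y * ((#Q / ⌈(#Q : ℝ) / ρ⌉₊ : ℕ) +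
        (#W / ⌈(#W : ℝ) / ρ⌉₊ : ℕ) + 1) + (#Q * ⌈(#Q : ℝ) / ρ⌉₊) * (#W * ⌈(#W : ℝ) / ρ⌉₊) := by
      exact_mod_cast hblock _ _ hd0 he0
    rw [← hL] at hb
    have hb' : (#Q * #W * t : ℝ) ≤ L * (3 * ρ) +
        (#Q * (2 * (#Q / ρ))) * (#W * (2 * (#W / ρ))) := by
      refine hb.trans (add_le_add ?_ ?_)
      · gcongr; linarith
      · gcongr
    have hmul : (#Q * #W * t : ℝ) * ρ ^ 2 ≤ 8 * (#Q * #W) ^ 2 := by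
      have : (#Q * #W * t : ℝ) ≤ 2 * ((#Q * (2 * (#Q / ρ))) * (#W * (2 * (#W / ρ)))) := by
        linarith
      calc (#Q * #W * t : ℝ) * ρ ^ 2
          ≤ 2 * ((#Q * (2 * (#Q / ρ))) * (#W * (2 * (#W / ρ)))) * ρ ^ 2 := by gcongr
        _ = _ := by field_simp; ring
    have hfin : (#Q * #W * t ^ 3 : ℝ) * (#Q * #W) ^ 2 ≤ 288 * L ^ 2 * (#Q * #W) ^ 2 := by
      calc (#Q * #W * t ^ 3 : ℝ) * (#Q * #W) ^ 2 = (#Q * #W * t) * (#Q * #W * t) ^ 2 := by ring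
        _ = ((#Q * #W * t) * ρ ^ 2) * (36 * L ^ 2) := by rw [← hρL]; ring
        _ ≤ (8 * (#Q * #W) ^ 2) * (36 * L ^ 2) := by gcongr
        _ = _ := by ring
    exact le_of_mul_le_mul_right hfin (by positivity)

lemma diffRep_level_bound (B X Y W : Finset ℝ) (hB : 0 ∉ B) (hX : 0 ∉ X) (t : ℕ)
    (hW : ∀ w ∈ W, t ≤ diffRep X Y w) :
    (#B * #W * t ^ 3 : ℝ) ≤ 288 * (#(B * X) * #Y : ℝ) ^ 2 := by
  classical
  have h := rich_grid_bound B⁻¹ W (B * X) Y (by simpa using hB)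
    (fun h0 => by
      obtain ⟨b, hb, x, hx, hbx⟩ := mem_mul.1 h0
      rcases mul_eq_zero.1 hbx with rfl | rfl
      · exact hB hb
      · exact hX hx) t ?_
  · rwa [card_inv] at h
  · intro q hq w hw
    obtain ⟨b, hb, rfl⟩ := mem_inv.1 hq
    have hb0 : b ≠ 0 := fun h0 => hB (h0 ▸ hb)
    refine (hW w hw).trans (card_le_card_of_injOn (fun z => (b * z.1, z.2)) ?_ ?_)
    · intro z hz
      simp only [coe_filter, mem_product, Set.mem_ofPred_eq] at hz ⊢
      refine ⟨⟨mul_mem_mul hb hz.1.1, hz.1.2⟩, ?_⟩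
      rw [mul_comm, inv_mul_cancel_left₀ hb0]
      exact hz.2
    · intro z _ z' _ heq
      simp only [Prod.mk.injEq] at heq
      ext
      · exact mul_left_cancel₀ hb0 heq.1
      · exact heq.2

lemma pow_succ_le_sum_Icc (s k : ℕ) : k ^ (s + 1) ≤ ∑ t ∈ Icc 1 k, (s + 1) * t ^ s := by
  have step : ∀ s k : ℕ, (k + 1) ^ (s + 1) ≤ k ^ (s + 1) + (s + 1) * (k + 1) ^ s := by
    intro s k
    induction s with
    | zero => simp
    | succ s ih =>
      have h1 : k ^ (s + 1) ≤ (k + 1) ^ (s + 1) := Nat.pow_le_pow_left (Nat.le_succ k) _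
      calc (k + 1) ^ (s + 1 + 1) = (k + 1) ^ (s + 1) * (k + 1) := pow_succ _ _
        _ ≤ (k ^ (s + 1) + (s + 1) * (k + 1) ^ s) * (k + 1) := Nat.mul_le_mul_right _ ih
        _ = k ^ (s + 1 + 1) + k ^ (s + 1) + (s + 1) * (k + 1) ^ (s + 1) := by ring
        _ ≤ k ^ (s + 1 + 1) + (k + 1) ^ (s + 1) + (s + 1) * (k + 1) ^ (s + 1) := by gcongr
        _ = _ := by ring
  induction k with
  | zero => simp
  | succ k ih =>
    rw [sum_Icc_succ_top (by omega)]
    exact (step s k).trans (Nat.add_le_add_right ih _)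

/-- A weak-type bound on the level sets of `F` controls its moment up to a harmonic sum. -/
lemma sum_pow_le_of_level_bound {S : Finset ℝ} {F : ℝ → ℕ} {N s : ℕ} {K : ℝ}
    (hF : ∀ w ∈ S, F w ≤ N)
    (hK : ∀ t : ℕ, 1 ≤ t → (#{w ∈ S | t ≤ F w} * t ^ (s + 1) : ℝ) ≤ K) :
    (∑ w ∈ S, (F w : ℝ) ^ (s + 1)) ≤ (s + 1) * K * (harmonic N : ℝ) := by
  classical
  have h1 : ∑ w ∈ S, F w ^ (s + 1) ≤ ∑ t ∈ Icc 1 N, (s + 1) * t ^ s * #{w ∈ S | t ≤ F w} := by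
    calc ∑ w ∈ S, F w ^ (s + 1)
        ≤ ∑ w ∈ S, ∑ t ∈ Icc 1 N, if t ≤ F w then (s + 1) * t ^ s else 0 := by
          refine sum_le_sum fun w hw => (pow_succ_le_sum_Icc s (F w)).trans (le_of_eq ?_)
          rw [← sum_filter]
          congr 1
          ext t
          have := hF w hw
          simp only [mem_Icc, mem_filter]
          omega
      _ = _ := by
          rw [sum_comm]
          refine sum_congr rfl fun t _ => ?_
          rw [← sum_filter, sum_const, smul_eq_mul, mul_comm]
  have h2 : (∑ w ∈ S, (F w : ℝ) ^ (s + 1)) ≤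
      ∑ t ∈ Icc 1 N, ((s : ℝ) + 1) * (t : ℝ) ^ s * (#{w ∈ S | t ≤ F w} : ℝ) := by
    exact_mod_cast h1
  refine h2.trans ?_
  rw [harmonic_eq_sum_Icc]
  push_cast
  rw [mul_sum]
  refine sum_le_sum fun t ht => ?_
  have ht1 := (mem_Icc.1 ht).1
  have ht0 : (0 : ℝ) < t := by exact_mod_cast ht1
  rw [← div_eq_mul_inv, le_div_iff₀ ht0]
  have := hK t ht1
  calc _ = ((s : ℝ) + 1) * (#{w ∈ S | t ≤ F w} * (t : ℝ) ^ (s + 1)) := by ring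
    _ ≤ _ := by gcongr

lemma diffRep_neg (A : Finset ℝ) (w : ℝ) : diffRep A A (-w) = diffRep A A w := by
  refine card_bij' (fun z _ => z.swap) (fun z _ => z.swap) ?_ ?_ ?_ ?_
  · intro z hz
    simp only [mem_filter, mem_product, Prod.fst_swap, Prod.snd_swap] at hz ⊢
    exact ⟨⟨hz.1.2, hz.1.1⟩, by linarith [hz.2]⟩
  · intro z hz
    simp only [mem_filter, mem_product, Prod.fst_swap, Prod.snd_swap] at hz ⊢
    exact ⟨⟨hz.1.2, hz.1.1⟩, by linarith [hz.2]⟩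
  · simp
  · simp

lemma diffRep_le_card (A B : Finset ℝ) (w : ℝ) : diffRep A B w ≤ #A := by
  refine card_le_card_of_injOn Prod.fst ?_ ?_
  · intro z hz
    simp only [coe_filter, mem_product, Set.mem_ofPred_eq] at hz
    exact hz.1.1
  · intro z hz z' hz' heq
    simp only [coe_filter, Set.mem_ofPred_eq] at hz hz'
    ext
    · exact heq
    · linarith [hz.2, hz'.2]

lemma mem_sub_of_diffRep_pos {A B : Finset ℝ} {w : ℝ} (h : 0 < diffRep A B w) : w ∈ A - B := by
  obtain ⟨z, hz⟩ := card_pos.1 h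
  simp only [mem_filter, mem_product] at hz
  exact hz.2 ▸ sub_mem_sub hz.1.1 hz.1.2

lemma diffRep_sub_eq_sum (A : Finset ℝ) {y z : ℝ} (hy : y ∈ A) :
    (diffRep A A (y - z) : ℝ) =
      ∑ v ∈ A - A, (if v + y ∈ A then (1 : ℝ) else 0) * (if v + z ∈ A then 1 else 0) := by
  simp only [← ite_and, mul_ite, mul_one, mul_zero]
  rw [← sum_filter, sum_const, nsmul_one, diffRep, Nat.cast_inj]
  refine card_bij' (fun p _ => p.1 - y) (fun v _ => (v + y, v + z)) ?_ ?_ ?_ ?_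
  · intro p hp
    simp only [mem_filter, mem_product] at hp ⊢
    refine ⟨sub_mem_sub hp.1.1 hy, ?_, ?_⟩
    · have : p.1 - y + z = p.2 := by linarith [hp.2]
      rw [this]; exact hp.1.2
    · simpa using hp.1.1
  · intro v hv
    simp only [mem_filter, mem_product] at hv ⊢
    exact ⟨⟨hv.2.2, hv.2.1⟩, by ring⟩
  · intro p hp
    simp only [mem_filter, mem_product] at hp ⊢
    ext <;> simp only <;> linarith [hp.2]
  · intro v _
    simp

/-- The number of `y ∈ A` with `x - y ∈ D`. -/
noncomputable def diffDeg (A D : Finset ℝ) (x : ℝ) : ℝ := ∑ y ∈ A, if x - y ∈ D then 1 else 0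

/-- Triples `x, y, z ∈ A` with `x - y, x - z ∈ D`, weighted by the number of representations
of `y - z`. -/
noncomputable def weightedTriangles (A D : Finset ℝ) : ℝ :=
  ∑ x ∈ A, ∑ y ∈ A, ∑ z ∈ A,
    (if x - y ∈ D then (1 : ℝ) else 0) * (if x - z ∈ D then 1 else 0) * diffRep A A (y - z)

lemma weightedTriangles_ge_quadratic (A D : Finset ℝ) (hD : ∀ d ∈ D, -d ∈ D) :
    ∑ y ∈ A, ∑ z ∈ A, diffDeg A D y * diffDeg A D z * diffRep A A (y - z)
      ≤ #A * weightedTriangles A D := by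
  have hsymm : ∀ x y, x - y ∈ D ↔ y - x ∈ D := fun x y =>
    ⟨fun h => by simpa using hD _ h, fun h => by simpa using hD _ h⟩
  have expand : ∀ f : ℝ → ℝ, ∑ y ∈ A, ∑ z ∈ A, f y * f z * diffRep A A (y - z) =
      ∑ v ∈ A - A, (∑ y ∈ A, f y * if v + y ∈ A then 1 else 0) ^ 2 := by
    intro f
    simp only [sq, sum_mul_sum]
    rw [sum_comm (s := A - A)]
    refine sum_congr rfl fun y hy => ?_
    rw [sum_comm (s := A - A)]
    refine sum_congr rfl fun z _ => ?_
    rw [diffRep_sub_eq_sum A hy, mul_sum]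
    exact sum_congr rfl fun v _ => by ring
  rw [expand, weightedTriangles]
  simp only [expand]
  rw [sum_comm, mul_sum]
  refine sum_le_sum fun v _ => ?_
  refine le_trans (le_of_eq ?_) sq_sum_le_card_mul_sum_sq
  congr 1
  rw [sum_comm]
  refine sum_congr rfl fun y _ => ?_
  rw [diffDeg, sum_mul]
  exact sum_congr rfl fun x _ => by simp only [hsymm y x]

/-- Lower bound for the number of three-step walks in a graph. -/
lemma three_walks_ge (A : Finset ℝ) (T : ℝ → ℝ → ℝ) (hT : ∀ x y, 0 ≤ T x y)
    (hTs : ∀ x y, T x y = T y x) :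
    (∑ x ∈ A, ∑ y ∈ A, T x y) ^ 3 ≤
      32 * #A ^ 2 * ∑ x ∈ A, ∑ y ∈ A, T x y * (∑ z ∈ A, T x z) * ∑ z ∈ A, T y z := by
  rcases A.eq_empty_or_nonempty with rfl | hA
  · simp
  have hn : (0 : ℝ) < #A := by exact_mod_cast hA.card_pos
  set g : ℝ → ℝ := fun x => ∑ z ∈ A, T x z with hg
  have hg0 : ∀ x, 0 ≤ g x := fun x => sum_nonneg fun z _ => hT x z
  obtain ⟨σ, hσ⟩ : ∃ σ, σ = ∑ x ∈ A, g x := ⟨_, rfl⟩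
  have hσ0 : 0 ≤ σ := hσ ▸ sum_nonneg fun x _ => hg0 x
  obtain ⟨τ, hτ⟩ : ∃ τ, τ = σ / (4 * #A) := ⟨_, rfl⟩
  have hτ0 : 0 ≤ τ := by rw [hτ]; positivity
  have hτσ : #A * τ = σ / 4 := by rw [hτ]; field_simp
  have hbad : ∑ x ∈ A, (if g x < τ then g x else 0) ≤ σ / 4 := by
    calc _ ≤ ∑ x ∈ A, τ := sum_le_sum fun x _ => by split_ifs with h; exacts [h.le, hτ0]
      _ = _ := by rw [sum_const, nsmul_eq_mul, hτσ]
  have hpt : ∀ x y, T x y * τ ^ 2 ≤ T x y * g x * g y +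
      τ ^ 2 * ((if g x < τ then T x y else 0) + (if g y < τ then T x y else 0)) := by
    intro x y
    have h0 := hT x y
    have hx := hg0 x
    have hy := hg0 y
    have hp : 0 ≤ T x y * g x * g y := by positivity
    have hq : 0 ≤ τ ^ 2 * T x y := by positivity
    split_ifs with h1 h2 h2
    · nlinarith
    · nlinarith
    · nlinarith
    · have : τ * τ ≤ g x * g y := mul_le_mul (not_lt.1 h1) (not_lt.1 h2) hτ0 hx
      nlinarith
  have hsum := sum_le_sum fun x (_ : x ∈ A) => sum_le_sum fun y (_ : y ∈ A) => hpt x y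
  simp only [sum_add_distrib, ← mul_sum, ← sum_mul] at hsum
  have hb1 : ∑ x ∈ A, ∑ y ∈ A, (if g x < τ then T x y else 0) ≤ σ / 4 := by
    refine le_trans (le_of_eq (sum_congr rfl fun x _ => ?_)) hbad
    split_ifs <;> simp [hg]
  have hb2 : ∑ x ∈ A, ∑ y ∈ A, (if g y < τ then T x y else 0) ≤ σ / 4 := by
    rw [sum_comm]
    refine le_trans (le_of_eq (sum_congr rfl fun x _ => ?_)) hbad
    split_ifs
    · exact sum_congr rfl fun y _ => hTs y x
    · simp
  have hmain : σ * τ ^ 2 ≤ 2 * ∑ x ∈ A, ∑ y ∈ A, T x y * g x * g y := by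
    have hs : (∑ x ∈ A, ∑ y ∈ A, T x y) = σ := hσ.symm
    rw [hs] at hsum
    nlinarith [sq_nonneg τ]
  have hs : (∑ x ∈ A, ∑ y ∈ A, T x y) = σ := hσ.symm
  rw [hs]
  calc σ ^ 3 = 16 * #A ^ 2 * (σ * τ ^ 2) := by rw [hτ]; field_simp; norm_num
    _ ≤ 16 * #A ^ 2 * (2 * ∑ x ∈ A, ∑ y ∈ A, T x y * g x * g y) := by gcongr
    _ = _ := by ring

lemma weightedTriangles_lower (A D : Finset ℝ) (hD : ∀ d ∈ D, -d ∈ D) (Δ : ℕ)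
    (hΔ : ∀ d ∈ D, Δ ≤ diffRep A A d) :
    (Δ * (#D * Δ) ^ 3 : ℝ) ≤ 32 * #A ^ 3 * weightedTriangles A D := by
  have hsymm : ∀ x y, x - y ∈ D ↔ y - x ∈ D := fun x y =>
    ⟨fun h => by simpa using hD _ h, fun h => by simpa using hD _ h⟩
  have hwalk := three_walks_ge A (fun x y => if x - y ∈ D then 1 else 0)
    (fun x y => by split_ifs <;> norm_num) (fun x y => by simp only [hsymm x y])
  have hdeg : (#D * Δ : ℝ) ≤ ∑ x ∈ A, ∑ y ∈ A, if x - y ∈ D then (1 : ℝ) else 0 := by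
    have h1 : #D * Δ ≤ #{z ∈ A ×ˢ A | z.1 - z.2 ∈ D} := by
      rw [card_eq_sum_card_fiberwise (s := {z ∈ A ×ˢ A | z.1 - z.2 ∈ D})
        (f := fun z : ℝ × ℝ => z.1 - z.2) (t := D) (fun z hz => (mem_filter.1 hz).2),
        ← smul_eq_mul, ← sum_const]
      refine sum_le_sum fun d hd => (hΔ d hd).trans (card_le_card fun z hz => ?_)
      simp only [mem_filter] at hz ⊢
      exact ⟨⟨hz.1, hz.2 ▸ hd⟩, hz.2⟩
    rw [← sum_product', ← sum_filter, sum_const, nsmul_one]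
    exact_mod_cast h1
  have hquad : (Δ : ℝ) * ∑ x ∈ A, ∑ y ∈ A, (if x - y ∈ D then (1 : ℝ) else 0) *
      diffDeg A D x * diffDeg A D y ≤ #A * weightedTriangles A D := by
    refine le_trans ?_ (weightedTriangles_ge_quadratic A D hD)
    rw [mul_sum]
    refine sum_le_sum fun x _ => ?_
    rw [mul_sum]
    refine sum_le_sum fun y _ => ?_
    have hx : 0 ≤ diffDeg A D x := sum_nonneg fun y _ => by split_ifs <;> norm_num
    have hy : 0 ≤ diffDeg A D y := sum_nonneg fun y _ => by split_ifs <;> norm_num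
    split_ifs with h
    · have : (Δ : ℝ) ≤ diffRep A A (x - y) := by exact_mod_cast hΔ _ h
      calc _ = diffDeg A D x * diffDeg A D y * Δ := by ring
        _ ≤ _ := by gcongr
    · simp only [zero_mul, mul_zero]
      positivity
  calc (Δ * (#D * Δ) ^ 3 : ℝ)
      ≤ Δ * (∑ x ∈ A, ∑ y ∈ A, if x - y ∈ D then (1 : ℝ) else 0) ^ 3 := by gcongr
    _ ≤ Δ * (32 * #A ^ 2 * ∑ x ∈ A, ∑ y ∈ A, (if x - y ∈ D then (1 : ℝ) else 0) *
      diffDeg A D x * diffDeg A D y) := mul_le_mul_of_nonneg_left hwalk (by positivity)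
    _ = 32 * #A ^ 2 * (Δ * ∑ x ∈ A, ∑ y ∈ A, (if x - y ∈ D then (1 : ℝ) else 0) *
      diffDeg A D x * diffDeg A D y) := by ring
    _ ≤ 32 * #A ^ 2 * (#A * weightedTriangles A D) := by gcongr
    _ = _ := by ring

/-- The third moment of the number of representations as a difference. -/
noncomputable def thirdEnergy (A : Finset ℝ) : ℝ := ∑ w ∈ A - A, (diffRep A A w : ℝ) ^ 3

lemma thirdEnergy_nonneg (A : Finset ℝ) : 0 ≤ thirdEnergy A :=
  sum_nonneg fun _ _ => by positivity

lemma sum_diffRep_cube_le (A S : Finset ℝ) :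
    ∑ w ∈ S, (diffRep A A w : ℝ) ^ 3 ≤ thirdEnergy A := by
  classical
  calc _ = ∑ w ∈ S with 0 < diffRep A A w, (diffRep A A w : ℝ) ^ 3 := by
        refine (sum_filter_of_ne fun w _ h => ?_).symm
        by_contra h0
        apply h
        simp [Nat.eq_zero_of_not_pos h0]
    _ ≤ _ := by
        refine sum_le_sum_of_subset_of_nonneg (fun w hw => ?_) fun _ _ _ => by positivity
        exact mem_sub_of_diffRep_pos (mem_filter.1 hw).2

/-- The number of `x ∈ A` with `x - α ∈ A` and `x - β ∈ A`. -/
noncomputable def shiftRep (A : Finset ℝ) (α β : ℝ) : ℕ := #{x ∈ A | x - α ∈ A ∧ x - β ∈ A}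

lemma sum_shiftRep_sq_le (A D : Finset ℝ) :
    ∑ p ∈ D ×ˢ D, (shiftRep A p.1 p.2 : ℝ) ^ 2 ≤ thirdEnergy A := by
  classical
  have h : ∑ p ∈ D ×ˢ D, shiftRep A p.1 p.2 ^ 2 ≤ ∑ w ∈ A - A, diffRep A A w ^ 3 := by
    have e1 : ∀ p : ℝ × ℝ, shiftRep A p.1 p.2 ^ 2 =
        #({x ∈ A | x - p.1 ∈ A ∧ x - p.2 ∈ A} ×ˢ {x ∈ A | x - p.1 ∈ A ∧ x - p.2 ∈ A}) := by
      intro p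
      rw [card_product, sq, shiftRep]
    have e2 : ∀ w : ℝ, diffRep A A w ^ 3 =
        #({z ∈ A ×ˢ A | z.1 - z.2 = w} ×ˢ {z ∈ A ×ˢ A | z.1 - z.2 = w} ×ˢ
          {z ∈ A ×ˢ A | z.1 - z.2 = w}) := by
      intro w
      rw [card_product, card_product, diffRep]
      ring
    simp only [e1, e2]
    rw [← card_sigma, ← card_sigma]
    refine card_le_card_of_injOn (fun z => ⟨z.2.1 - z.2.2, (z.2.1, z.2.2),
      (z.2.1 - z.1.1, z.2.2 - z.1.1), (z.2.1 - z.1.2, z.2.2 - z.1.2)⟩) ?_ ?_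
    · rintro ⟨⟨α, β⟩, ⟨x, y⟩⟩ hz
      simp only [mem_coe, mem_sigma, mem_product, mem_filter] at hz ⊢
      obtain ⟨-, ⟨hx, hxα, hxβ⟩, hy, hyα, hyβ⟩ := hz
      exact ⟨sub_mem_sub hx hy, ⟨⟨hx, hy⟩, trivial⟩, ⟨⟨hxα, hyα⟩, by ring⟩, ⟨hxβ, hyβ⟩, by ring⟩
    · rintro ⟨⟨α, β⟩, ⟨x, y⟩⟩ - ⟨⟨α', β'⟩, ⟨x', y'⟩⟩ - heq
      simp only [Sigma.mk.injEq, heq_eq_eq, Prod.mk.injEq] at heq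
      obtain ⟨-, ⟨rfl, rfl⟩, ⟨h1, -⟩, h2, -⟩ := heq
      obtain rfl : α = α' := by linarith
      obtain rfl : β = β' := by linarith
      rfl
  rw [thirdEnergy]
  exact_mod_cast h

lemma sum_ite_sub_mem (A D : Finset ℝ) (x : ℝ) (f : ℝ → ℝ) :
    ∑ y ∈ A, (if x - y ∈ D then f y else 0) = ∑ α ∈ D, if x - α ∈ A then f (x - α) else 0 := by
  rw [← sum_filter, ← sum_filter]
  refine sum_bij' (fun y _ => x - y) (fun α _ => x - α) ?_ ?_ ?_ ?_ ?_
  · intro y hy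
    simpa [and_comm] using hy
  · intro y hy
    simpa [and_comm] using hy
  all_goals simp

lemma weightedTriangles_eq_sum (A D : Finset ℝ) :
    weightedTriangles A D =
      ∑ p ∈ D ×ˢ D, (diffRep A A (p.1 - p.2) : ℝ) * shiftRep A p.1 p.2 := by
  calc weightedTriangles A D
      = ∑ x ∈ A, ∑ α ∈ D, ∑ β ∈ D, if x - α ∈ A ∧ x - β ∈ A then
          (diffRep A A (α - β) : ℝ) else 0 := by
        refine sum_congr rfl fun x _ => ?_
        have h1 : ∀ y, ∑ z ∈ A, (if x - y ∈ D then (1 : ℝ) else 0) *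
            (if x - z ∈ D then 1 else 0) * diffRep A A (y - z) =
            if x - y ∈ D then ∑ β ∈ D, (if x - β ∈ A then
              (diffRep A A (y - (x - β)) : ℝ) else 0) else 0 := by
          intro y
          rw [← sum_ite_sub_mem A D x fun z => (diffRep A A (y - z) : ℝ)]
          split_ifs <;> simp
        simp only [h1]
        rw [sum_ite_sub_mem]
        refine sum_congr rfl fun α _ => ?_
        split_ifs with h
        · refine sum_congr rfl fun β _ => ?_
          rw [← diffRep_neg A (α - β)]
          simp only [h, true_and]
          congr 3
          ring
        · simp [h]
    _ = _ := by
        rw [sum_comm, sum_product]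
        refine sum_congr rfl fun α _ => ?_
        rw [sum_comm]
        refine sum_congr rfl fun β _ => ?_
        rw [← sum_filter, sum_const, nsmul_eq_mul, mul_comm, shiftRep]

lemma sum_mul_sq_pow_three_le {ι : Type*} (S : Finset ι) (u v : ι → ℝ) (hu : ∀ i, 0 ≤ u i)
    (hv : ∀ i, 0 ≤ v i) :
    (∑ i ∈ S, u i * v i ^ 2) ^ 3 ≤ (∑ i ∈ S, u i ^ 3) * (∑ i ∈ S, v i ^ 3) ^ 2 := by
  have h := Real.inner_le_Lp_mul_Lq_of_nonneg S (p := 3) (q := 3 / 2)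
    (f := u) (g := fun i => v i ^ 2) (by constructor <;> norm_num)
    (fun i _ => hu i) (fun i _ => by positivity)
  have hvv : ∀ i, (v i ^ 2) ^ (3 / 2 : ℝ) = v i ^ 3 := by
    intro i
    rw [← Real.rpow_natCast, ← Real.rpow_mul (hv i), ← Real.rpow_natCast]
    norm_num
  have huu : ∀ i, u i ^ (3 : ℝ) = u i ^ 3 := fun i => by
    rw [← Real.rpow_natCast]; norm_num
  simp only [hvv, huu] at h
  have hU : 0 ≤ ∑ i ∈ S, u i ^ 3 := sum_nonneg fun i _ => pow_nonneg (hu i) 3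
  have hV : 0 ≤ ∑ i ∈ S, v i ^ 3 := sum_nonneg fun i _ => pow_nonneg (hv i) 3
  have h0 : 0 ≤ ∑ i ∈ S, u i * v i ^ 2 :=
    sum_nonneg fun i _ => mul_nonneg (hu i) (by positivity)
  refine (pow_le_pow_left₀ h0 h 3).trans (le_of_eq ?_)
  rw [mul_pow]
  congr 1
  · rw [← Real.rpow_natCast, ← Real.rpow_mul hU]; norm_num
  · rw [← Real.rpow_natCast, ← Real.rpow_mul hV, ← Real.rpow_natCast]; norm_num

lemma weightedTriangles_pow_six_le (A D : Finset ℝ) :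
    weightedTriangles A D ^ 6 ≤ thirdEnergy A ^ 5 * thirdEnergy D := by
  classical
  have hcs : weightedTriangles A D ^ 2 ≤
      (∑ p ∈ D ×ˢ D, (diffRep A A (p.1 - p.2) : ℝ) ^ 2) * thirdEnergy A := by
    rw [weightedTriangles_eq_sum]
    refine (sum_mul_sq_le_sq_mul_sq _ _ _).trans ?_
    exact mul_le_mul_of_nonneg_left (sum_shiftRep_sq_le A D)
      (sum_nonneg fun _ _ => by positivity)
  have hfib : ∑ p ∈ D ×ˢ D, (diffRep A A (p.1 - p.2) : ℝ) ^ 2 =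
      ∑ w ∈ D - D, (diffRep D D w : ℝ) * (diffRep A A w : ℝ) ^ 2 := by
    rw [← sum_fiberwise_of_maps_to (s := D ×ˢ D) (t := D - D) (g := fun p => p.1 - p.2)
      (fun p hp => sub_mem_sub (mem_product.1 hp).1 (mem_product.1 hp).2)]
    refine sum_congr rfl fun w _ => ?_
    rw [diffRep, ← nsmul_eq_mul, ← sum_const]
    exact sum_congr rfl fun p hp => by rw [(mem_filter.1 hp).2]
  have hS := sum_mul_sq_pow_three_le (D - D) (fun w => (diffRep D D w : ℝ))
    (fun w => (diffRep A A w : ℝ)) (fun _ => by positivity) (fun _ => by positivity)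
  rw [← hfib] at hS
  have hA := sum_diffRep_cube_le A (D - D)
  have hA0 := thirdEnergy_nonneg A
  have hD0 := thirdEnergy_nonneg D
  have hS' : (∑ p ∈ D ×ˢ D, (diffRep A A (p.1 - p.2) : ℝ) ^ 2) ^ 3 ≤
      thirdEnergy D * thirdEnergy A ^ 2 := by
    refine hS.trans ?_
    have : 0 ≤ ∑ w ∈ D - D, (diffRep A A w : ℝ) ^ 3 := sum_nonneg fun _ _ => by positivity
    change thirdEnergy D * _ ≤ _
    gcongr
  calc weightedTriangles A D ^ 6 = (weightedTriangles A D ^ 2) ^ 3 := by ring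
    _ ≤ ((∑ p ∈ D ×ˢ D, (diffRep A A (p.1 - p.2) : ℝ) ^ 2) * thirdEnergy A) ^ 3 := by gcongr
    _ = (∑ p ∈ D ×ˢ D, (diffRep A A (p.1 - p.2) : ℝ) ^ 2) ^ 3 * thirdEnergy A ^ 3 := by ring
    _ ≤ thirdEnergy D * thirdEnergy A ^ 2 * thirdEnergy A ^ 3 := by gcongr
    _ = _ := by ring

lemma exists_subset_card_mul_mul_le {G : Type*} [CommGroup G] [DecidableEq G] {A : Finset G}
    (hA : A.Nonempty) :
    ∃ X ⊆ A, X.Nonempty ∧ #(X * (A * A)) * #A ^ 2 ≤ #(A * A) ^ 2 * #X := by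
  obtain ⟨X, hX, hmin⟩ := exists_min_image (A.powerset.erase ∅)
    (fun X => (#(X * A) / #X : ℚ)) ⟨A, by simp [hA.ne_empty]⟩
  simp only [mem_erase, mem_powerset, ← nonempty_iff_ne_empty] at hX hmin
  have hX0 : (0 : ℚ) < #X := by exact_mod_cast hX.1.card_pos
  have hle : ∀ X' ⊆ A, #(X * A) * #X' ≤ #(X' * A) * #X := by
    intro X' hX'
    rcases X'.eq_empty_or_nonempty with rfl | hne
    · simp
    have h := hmin X' ⟨hne, hX'⟩
    rw [div_le_div_iff₀ hX0 (by exact_mod_cast hne.card_pos)] at h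
    exact_mod_cast h
  refine ⟨X, hX.2, hX.1, ?_⟩
  have hp := pluennecke_petridis_inequality_mul (A := X) (B := A) A
    fun X' hX' => hle X' (hX'.trans hX.2)
  have h1 := hle A Subset.rfl
  rw [mul_comm A X, mul_assoc] at hp
  refine Nat.le_of_mul_le_mul_right ?_ hX.1.card_pos
  calc #(X * (A * A)) * #A ^ 2 * #X = #(X * (A * A)) * #X * #A ^ 2 := by ring
    _ ≤ #(X * A) * #(X * A) * #A ^ 2 := by gcongr
    _ = (#(X * A) * #A) ^ 2 := by ring
    _ ≤ (#(A * A) * #X) ^ 2 := by gcongr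
    _ = _ := by ring

lemma exists_subset_card_mul_mul_le_of_zero_notMem {A : Finset ℝ} (hA : A.Nonempty) (h0 : 0 ∉ A) :
    ∃ X ⊆ A, X.Nonempty ∧ #(X * (A * A)) * #A ^ 2 ≤ #(A * A) ^ 2 * #X := by
  classical
  have hinj : Function.Injective (Units.coeHom ℝ) := fun _ _ h => Units.ext h
  obtain ⟨U, rfl⟩ : ∃ U : Finset ℝˣ, U.image (Units.coeHom ℝ) = A := by
    refine ⟨A.preimage (Units.coeHom ℝ) hinj.injOn, ?_⟩
    rw [image_preimage]
    refine filter_true_of_mem fun x hx => ?_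
    exact ⟨Units.mk0 x fun h => h0 (h ▸ hx), rfl⟩
  obtain ⟨X, hXU, hX, h⟩ := exists_subset_card_mul_mul_le (image_nonempty.1 hA)
  refine ⟨X.image (Units.coeHom ℝ), image_subset_image hXU, hX.image _, ?_⟩
  simpa only [← image_mul, card_image_of_injective _ hinj] using h

lemma diffRep_le_diffRep_mul (A : Finset ℝ) {a : ℝ} (ha : a ∈ A) (ha0 : a ≠ 0) (d : ℝ) :
    diffRep A A d ≤ diffRep (A * A) (A * A) (a * d) := by
  refine card_le_card_of_injOn (fun z => (a * z.1, a * z.2)) ?_ ?_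
  · intro z hz
    simp only [coe_filter, mem_product, Set.mem_ofPred_eq] at hz ⊢
    exact ⟨⟨mul_mem_mul ha hz.1.1, mul_mem_mul ha hz.1.2⟩, by rw [← hz.2]; ring⟩
  · intro z _ z' _ heq
    simp only [Prod.mk.injEq] at heq
    exact Prod.ext (mul_left_cancel₀ ha0 heq.1) (mul_left_cancel₀ ha0 heq.2)

lemma card_mul_popular_le {A : Finset ℝ} (hA : A.Nonempty) (h0 : 0 ∉ A) (D : Finset ℝ) (Δ : ℕ)
    (hD : ∀ d ∈ D, Δ ≤ diffRep A A d) :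
    (#(A * D) * Δ ^ 3 * #A ^ 3 : ℝ) ≤ 288 * #(A * A) ^ 6 := by
  obtain ⟨X, hXA, hX, hXm⟩ := exists_subset_card_mul_mul_le_of_zero_notMem hA h0
  have h0AA : (0 : ℝ) ∉ A * A := by
    intro h
    obtain ⟨a, ha, b, hb, hab⟩ := mem_mul.1 h
    rcases mul_eq_zero.1 hab with rfl | rfl
    exacts [h0 ha, h0 hb]
  have hb := diffRep_level_bound X (A * A) (A * A) (A * D) (fun h => h0 (hXA h)) h0AA Δ ?_
  · have hXm' : (#(X * (A * A)) * #A ^ 2 : ℝ) ≤ #(A * A) ^ 2 * #X := by exact_mod_cast hXm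
    have hX0 : (0 : ℝ) < #X := by exact_mod_cast hX.card_pos
    have hA0 : (0 : ℝ) < #A := by exact_mod_cast hA.card_pos
    have hXle : (#X : ℝ) ≤ #A := by exact_mod_cast card_le_card hXA
    refine le_of_mul_le_mul_right (a := (#X * #A : ℝ)) ?_ (by positivity)
    calc (#(A * D) * Δ ^ 3 * #A ^ 3 : ℝ) * (#X * #A)
        = (#X * #(A * D) * Δ ^ 3) * #A ^ 4 := by ring
      _ ≤ (288 * (#(X * (A * A)) * #(A * A) : ℝ) ^ 2) * #A ^ 4 := by gcongr
      _ = 288 * (#(X * (A * A)) * #A ^ 2) ^ 2 * #(A * A) ^ 2 := by ring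
      _ ≤ 288 * (#(A * A) ^ 2 * #X) ^ 2 * #(A * A) ^ 2 := by gcongr
      _ = (288 * #(A * A) ^ 6) * (#X * #X) := by ring
      _ ≤ (288 * #(A * A) ^ 6) * (#X * #A) := by gcongr
  · intro w hw
    obtain ⟨a, ha, d, hd, rfl⟩ := mem_mul.1 hw
    exact (hD d hd).trans (diffRep_le_diffRep_mul A ha (fun h => h0 (h ▸ ha)) d)

lemma harmonic_mono : Monotone harmonic := by
  refine monotone_nat_of_le_succ fun n => ?_
  rw [harmonic_succ]
  have : (0 : ℚ) ≤ ((n + 1 : ℕ) : ℚ)⁻¹ := by positivity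
  linarith

lemma thirdEnergy_le (B X : Finset ℝ) (hB : B.Nonempty) (hB0 : 0 ∉ B) (hX0 : 0 ∉ X) {N : ℕ}
    (hN : #X ≤ N) :
    #B * thirdEnergy X ≤ 864 * (#(B * X) * #X) ^ 2 * (harmonic N : ℝ) := by
  have hb : (0 : ℝ) < #B := by exact_mod_cast hB.card_pos
  have h := sum_pow_le_of_level_bound (S := X - X) (F := diffRep X X) (N := N) (s := 2)
    (K := 288 * (#(B * X) * #X : ℝ) ^ 2 / #B) (fun w _ => (diffRep_le_card X X w).trans hN) ?_
  · calc #B * thirdEnergy X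
        ≤ #B * (((2 : ℕ) + 1) * (288 * (#(B * X) * #X : ℝ) ^ 2 / #B) * (harmonic N : ℝ)) := by
          gcongr
          exact h
      _ = _ := by field_simp; push_cast; ring
  · intro t _
    rw [le_div_iff₀ hb]
    refine le_trans (le_of_eq ?_) (diffRep_level_bound B X X {w ∈ X - X | t ≤ diffRep X X w}
      hB0 hX0 t fun w hw => (mem_filter.1 hw).2)
    ring

lemma popular_differences_bound {A : Finset ℝ} (hA : A.Nonempty) (h0 : 0 ∉ A) (Δ : ℕ) :
    (#{w ∈ (A - A).erase 0 | Δ ≤ diffRep A A w} * Δ ^ 2 : ℝ) ^ 18 ≤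
      32 ^ 6 * 864 ^ 6 * 288 ^ 4 * #A ^ 18 * #(A * A) ^ 26 * (harmonic (#A ^ 2) : ℝ) ^ 6 := by
  set D := {w ∈ (A - A).erase 0 | Δ ≤ diffRep A A w} with hDdef
  have hH : (0 : ℝ) ≤ (harmonic (#A ^ 2) : ℝ) := by
    exact_mod_cast (harmonic_pos (by simpa using hA.ne_empty)).le
  rcases D.eq_empty_or_nonempty with hDe | hDn
  · rw [hDe]
    simp only [card_empty, Nat.cast_zero, zero_mul, ne_eq, OfNat.ofNat_ne_zero,
      not_false_eq_true, zero_pow]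
    positivity
  have hDr : ∀ d ∈ D, Δ ≤ diffRep A A d := fun d hd => (mem_filter.1 hd).2
  have hD0 : 0 ∉ D := by simp [hDdef]
  have hDs : ∀ d ∈ D, -d ∈ D := by
    intro d hd
    simp only [hDdef, mem_filter, mem_erase, neg_ne_zero, diffRep_neg] at hd ⊢
    refine ⟨⟨hd.1.1, ?_⟩, hd.2⟩
    obtain ⟨a, ha, b, hb, rfl⟩ := mem_sub.1 hd.1.2
    rw [neg_sub]
    exact sub_mem_sub hb ha
  have hDcard : #D ≤ #A ^ 2 := by
    calc #D ≤ #(A - A) := (card_filter_le _ _).trans (card_erase_le)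
      _ ≤ _ := by rw [sq]; exact card_sub_le
  have hAcard : #A ≤ #A ^ 2 := Nat.le_self_pow two_ne_zero _
  have hlow := weightedTriangles_lower A D hDs Δ hDr
  have hup := weightedTriangles_pow_six_le A D
  have hEA := thirdEnergy_le A A hA h0 h0 hAcard
  have hED := thirdEnergy_le A D hA h0 hD0 hDcard
  have hAD := card_mul_popular_le hA h0 D Δ hDr
  have hDl := diffRep_level_bound A A A D h0 h0 Δ hDr
  have hEA0 := thirdEnergy_nonneg A
  have hED0 := thirdEnergy_nonneg D
  have hTri : 0 ≤ weightedTriangles A D :=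
    sum_nonneg fun _ _ => sum_nonneg fun _ _ => sum_nonneg fun _ _ => by positivity
  have hn : (0 : ℝ) < #A := by exact_mod_cast hA.card_pos
  have hd : (0 : ℝ) < #D := by exact_mod_cast hDn.card_pos
  have hk : (0 : ℝ) ≤ #(A * D) := by positivity
  have hm : (0 : ℝ) ≤ #(A * A) := by positivity
  have hs : (0 : ℝ) ≤ Δ := by positivity
  generalize (harmonic (#A ^ 2) : ℝ) = H at *
  generalize (#(A * D) : ℝ) = k at *
  generalize weightedTriangles A D = T at *
  generalize thirdEnergy A = E at *
  generalize thirdEnergy D = F at *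
  generalize (#(A * A) : ℝ) = m at *
  generalize (#A : ℝ) = n at *
  generalize (#D : ℝ) = δ at *
  generalize (Δ : ℝ) = s at *
  have hE : E ≤ 864 * m ^ 2 * n * H := by
    refine le_of_mul_le_mul_left (hEA.trans_eq ?_) hn
    ring
  refine le_of_mul_le_mul_right (a := δ ^ 2 * n ^ 9) ?_ (by positivity)
  calc (δ * s ^ 2) ^ 18 * (δ ^ 2 * n ^ 9)
      = (s * (δ * s) ^ 3) ^ 6 * n * (s ^ 3 * n ^ 3) ^ 2 * (n * δ * s ^ 3) ^ 2 := by ring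
    _ ≤ (32 * n ^ 3 * T) ^ 6 * n * (s ^ 3 * n ^ 3) ^ 2 * (288 * (m * n) ^ 2) ^ 2 := by gcongr
    _ = (32 ^ 6 * n ^ 18) * T ^ 6 * n * (s ^ 3 * n ^ 3) ^ 2 * (288 * (m * n) ^ 2) ^ 2 := by ring
    _ ≤ (32 ^ 6 * n ^ 18) * (E ^ 5 * F) * n * (s ^ 3 * n ^ 3) ^ 2 *
        (288 * (m * n) ^ 2) ^ 2 := by gcongr
    _ = (32 ^ 6 * n ^ 18) * E ^ 5 * (n * F) * (s ^ 3 * n ^ 3) ^ 2 *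
        (288 * (m * n) ^ 2) ^ 2 := by ring
    _ ≤ (32 ^ 6 * n ^ 18) * (864 * m ^ 2 * n * H) ^ 5 * (864 * (k * δ) ^ 2 * H) *
        (s ^ 3 * n ^ 3) ^ 2 * (288 * (m * n) ^ 2) ^ 2 := by gcongr
    _ = (32 ^ 6 * n ^ 18) * (864 * m ^ 2 * n * H) ^ 5 * (864 * δ ^ 2 * H) *
        (k * s ^ 3 * n ^ 3) ^ 2 * (288 * (m * n) ^ 2) ^ 2 := by ring
    _ ≤ (32 ^ 6 * n ^ 18) * (864 * m ^ 2 * n * H) ^ 5 * (864 * δ ^ 2 * H) *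
        (288 * m ^ 6) ^ 2 * (288 * (m * n) ^ 2) ^ 2 := by gcongr
    _ = _ := by ring

lemma card_energy_le (A : Finset ℝ) :
    #{x ∈ A ×ˢ A ×ˢ A ×ˢ A | x.1 + x.2.1 = x.2.2.1 + x.2.2.2} ≤
      ∑ w ∈ A - A, diffRep A A w ^ 2 := by
  classical
  simp only [diffRep, sq, ← card_product]
  rw [← card_sigma]
  refine card_le_card_of_injOn (fun x => ⟨x.1 - x.2.2.1, (x.1, x.2.2.1), (x.2.2.2, x.2.1)⟩) ?_ ?_
  · rintro ⟨a, b, c, d⟩ hx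
    simp only [coe_filter, mem_product, Set.mem_ofPred_eq] at hx
    obtain ⟨⟨ha, hb, hc, hd⟩, h⟩ := hx
    simp only [coe_sigma, Set.mem_sigma_iff, mem_coe, mem_product, mem_filter]
    exact ⟨sub_mem_sub ha hc, ⟨⟨ha, hc⟩, trivial⟩, ⟨hd, hb⟩, by linarith⟩
  · rintro ⟨a, b, c, d⟩ - ⟨a', b', c', d'⟩ - heq
    simp only [Sigma.mk.injEq, heq_eq_eq, Prod.mk.injEq] at heq
    simp only [Prod.mk.injEq]
    tauto

lemma card_energy_le_erase_zero (A : Finset ℝ) :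
    #{x ∈ A ×ˢ A ×ˢ A ×ˢ A | x.1 + x.2.1 = x.2.2.1 + x.2.2.2} ≤
      #{x ∈ A.erase 0 ×ˢ A.erase 0 ×ˢ A.erase 0 ×ˢ A.erase 0 |
        x.1 + x.2.1 = x.2.2.1 + x.2.2.2} + 4 * #A ^ 2 := by
  classical
  set Q := {x ∈ A ×ˢ A ×ˢ A ×ˢ A | x.1 + x.2.1 = x.2.2.1 + x.2.2.2} with hQ
  have hcover : Q ⊆ {x ∈ A.erase 0 ×ˢ A.erase 0 ×ˢ A.erase 0 ×ˢ A.erase 0 |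
      x.1 + x.2.1 = x.2.2.1 + x.2.2.2} ∪ ({x ∈ Q | x.1 = 0} ∪ {x ∈ Q | x.2.1 = 0} ∪
      ({x ∈ Q | x.2.2.1 = 0} ∪ {x ∈ Q | x.2.2.2 = 0})) := by
    intro x hx
    simp only [hQ, mem_union, mem_filter, mem_product, mem_erase] at hx ⊢
    tauto
  have hplanes : (#{x ∈ Q | x.1 = 0} ≤ #(A ×ˢ A) ∧ #{x ∈ Q | x.2.1 = 0} ≤ #(A ×ˢ A)) ∧
      #{x ∈ Q | x.2.2.1 = 0} ≤ #(A ×ˢ A) ∧ #{x ∈ Q | x.2.2.2 = 0} ≤ #(A ×ˢ A) := by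
    refine ⟨⟨card_le_card_of_injOn (fun x => (x.2.1, x.2.2.1)) (fun x hx => ?_) ?_,
      card_le_card_of_injOn (fun x => (x.1, x.2.2.1)) (fun x hx => ?_) ?_⟩,
      card_le_card_of_injOn (fun x => (x.1, x.2.1)) (fun x hx => ?_) ?_,
      card_le_card_of_injOn (fun x => (x.1, x.2.1)) (fun x hx => ?_) ?_⟩
    any_goals
      simp only [hQ, coe_filter, mem_filter, mem_product, Set.mem_ofPred_eq] at hx
      simp only [coe_product, Set.mem_prod, mem_coe]
      tauto
    all_goals
      rintro ⟨a, b, c, d⟩ hx ⟨a', b', c', d'⟩ hx' heq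
      simp only [hQ, coe_filter, mem_filter, Set.mem_ofPred_eq] at hx hx'
      simp only [Prod.mk.injEq] at heq ⊢
      refine ⟨?_, ?_, ?_, ?_⟩ <;> linarith [hx.1.2, hx'.1.2, hx.2, hx'.2, heq.1, heq.2]
  rw [card_product, ← sq] at hplanes
  have hc := card_le_card hcover
  have hu := card_union_le {x ∈ A.erase 0 ×ˢ A.erase 0 ×ˢ A.erase 0 ×ˢ A.erase 0 |
      x.1 + x.2.1 = x.2.2.1 + x.2.2.2} ({x ∈ Q | x.1 = 0} ∪ {x ∈ Q | x.2.1 = 0} ∪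
      ({x ∈ Q | x.2.2.1 = 0} ∪ {x ∈ Q | x.2.2.2 = 0}))
  have hu' := card_union_le ({x ∈ Q | x.1 = 0} ∪ {x ∈ Q | x.2.1 = 0})
      ({x ∈ Q | x.2.2.1 = 0} ∪ {x ∈ Q | x.2.2.2 = 0})
  have hu1 := card_union_le {x ∈ Q | x.1 = 0} {x ∈ Q | x.2.1 = 0}
  have hu2 := card_union_le {x ∈ Q | x.2.2.1 = 0} {x ∈ Q | x.2.2.2 = 0}
  omega

lemma harmonic_sq_le {n : ℕ} (hn : 1 ≤ n) :
    (harmonic (n ^ 2) : ℝ) ≤ 481 * (n : ℝ) ^ (1 / 240 : ℝ) := by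
  have hn1 : (1 : ℝ) ≤ n := by exact_mod_cast hn
  have h1 := harmonic_le_one_add_log (n ^ 2)
  have h2 := Real.log_le_rpow_div (x := (n : ℝ)) (by positivity)
    (show (0 : ℝ) < 1 / 240 by norm_num)
  have h3 : (1 : ℝ) ≤ (n : ℝ) ^ (1 / 240 : ℝ) := Real.one_le_rpow hn1 (by norm_num)
  push_cast at h1
  rw [Real.log_pow] at h1
  push_cast at h1
  linarith

/-- An absolute constant for the energy bound. -/
def energyConst : ℝ := 32 ^ 6 * 864 ^ 6 * 288 ^ 4 * 481 ^ 24

lemma one_le_energyConst : 1 ≤ energyConst := by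
  norm_num [energyConst]

lemma energy_le_of_zero_notMem {A : Finset ℝ} (hA : A.Nonempty) (h0 : 0 ∉ A) {M : ℝ}
    (hM : 1 ≤ M) (hAA : (#(A * A) : ℝ) ≤ M * #A) :
    (#{x ∈ A ×ˢ A ×ˢ A ×ˢ A | x.1 + x.2.1 = x.2.2.1 + x.2.2.2} : ℝ) ≤
      #A ^ 2 + 4 * energyConst * (M ^ (8 / 5 : ℝ) * (#A : ℝ) ^ (49 / 20 : ℝ)) := by
  have hn : 1 ≤ #A := hA.card_pos
  have hn0 : (0 : ℝ) < #A := by exact_mod_cast hn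
  have hM0 : 0 < M := by linarith
  have hHn : (harmonic #A : ℝ) ≤ harmonic (#A ^ 2) := by
    exact_mod_cast harmonic_mono (Nat.le_self_pow two_ne_zero _)
  have hH := harmonic_sq_le hn
  have hH0 : (0 : ℝ) ≤ harmonic (#A ^ 2) := by
    exact_mod_cast (harmonic_pos (by simpa using hA.ne_empty)).le
  obtain ⟨Y, hY⟩ : ∃ Y : ℝ, Y = 32 ^ 6 * 864 ^ 6 * 288 ^ 4 * #A ^ 18 * #(A * A) ^ 26 *
    (harmonic (#A ^ 2) : ℝ) ^ 6 := ⟨_, rfl⟩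
  have hY0 : 0 ≤ Y := by rw [hY]; positivity
  obtain ⟨K, hK⟩ : ∃ K : ℝ, K = Y ^ ((18 : ℕ) : ℝ)⁻¹ := ⟨_, rfl⟩
  have hK0 : 0 ≤ K := by rw [hK]; positivity
  have hK18 : K ^ 18 = Y := by rw [hK]; exact Real.rpow_inv_natCast_pow hY0 (by norm_num)
  have hlevel : ∀ Δ : ℕ, (#{w ∈ (A - A).erase 0 | Δ ≤ diffRep A A w} * Δ ^ 2 : ℝ) ≤ K := by
    intro Δ
    refine le_of_pow_le_pow_left₀ (n := 18) (by norm_num) hK0 ?_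
    rw [hK18, hY]
    exact popular_differences_bound hA h0 Δ
  have hsum := sum_pow_le_of_level_bound (S := (A - A).erase 0) (F := diffRep A A) (N := #A)
    (s := 1) (K := K) (fun w _ => diffRep_le_card A A w) (fun t _ => hlevel t)
  have hKH : K * harmonic (#A ^ 2) ≤
      energyConst * (M ^ (8 / 5 : ℝ) * (#A : ℝ) ^ (49 / 20 : ℝ)) := by
    have hC := one_le_energyConst
    refine le_of_pow_le_pow_left₀ (n := 18) (by norm_num) (by positivity) ?_
    have e1 : ((#A : ℝ) ^ (1 / 240 : ℝ)) ^ 24 * #A ^ 44 = ((#A : ℝ) ^ (49 / 20 : ℝ)) ^ 18 := by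
      simp only [← Real.rpow_natCast, ← Real.rpow_mul hn0.le, ← Real.rpow_add hn0]
      norm_num
    have e2 : M ^ 26 ≤ (M ^ (8 / 5 : ℝ)) ^ 18 := by
      rw [← Real.rpow_natCast, ← Real.rpow_natCast, ← Real.rpow_mul hM0.le]
      exact Real.rpow_le_rpow_of_exponent_le hM (by norm_num)
    calc (K * (harmonic (#A ^ 2) : ℝ)) ^ 18
        = 32 ^ 6 * 864 ^ 6 * 288 ^ 4 * #A ^ 18 * #(A * A) ^ 26 *
          (harmonic (#A ^ 2) : ℝ) ^ 24 := by rw [mul_pow, hK18, hY]; ring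
      _ ≤ 32 ^ 6 * 864 ^ 6 * 288 ^ 4 * #A ^ 18 * (M * #A) ^ 26 *
          (481 * (#A : ℝ) ^ (1 / 240 : ℝ)) ^ 24 := by gcongr
      _ = energyConst * (M ^ 26 * (((#A : ℝ) ^ (1 / 240 : ℝ)) ^ 24 * #A ^ 44)) := by
          rw [energyConst]; ring
      _ = energyConst * (M ^ 26 * ((#A : ℝ) ^ (49 / 20 : ℝ)) ^ 18) := by rw [e1]
      _ ≤ energyConst ^ 18 * ((M ^ (8 / 5 : ℝ)) ^ 18 * ((#A : ℝ) ^ (49 / 20 : ℝ)) ^ 18) := by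
          gcongr
          exact le_self_pow₀ hC (by norm_num)
      _ = _ := by ring
  have hzero : (0 : ℝ) ∈ A - A := by
    obtain ⟨a, ha⟩ := hA
    exact mem_sub.2 ⟨a, ha, a, ha, sub_self a⟩
  have hr0 : (diffRep A A 0 : ℝ) ≤ #A := by exact_mod_cast diffRep_le_card A A 0
  have hE : (#{x ∈ A ×ˢ A ×ˢ A ×ˢ A | x.1 + x.2.1 = x.2.2.1 + x.2.2.2} : ℝ) ≤
      ∑ w ∈ A - A, (diffRep A A w : ℝ) ^ 2 := by exact_mod_cast card_energy_le A
  rw [← add_sum_erase _ _ hzero] at hE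
  calc _ ≤ _ := hE
    _ ≤ #A ^ 2 + ((1 : ℕ) + 1) * K * (harmonic #A : ℝ) := by gcongr
    _ ≤ #A ^ 2 + ((1 : ℕ) + 1) * K * (harmonic (#A ^ 2) : ℝ) := by gcongr
    _ = #A ^ 2 + 2 * (K * (harmonic (#A ^ 2) : ℝ)) := by push_cast; ring
    _ ≤ _ := by
      have : 0 ≤ K * (harmonic (#A ^ 2) : ℝ) := by positivity
      linarith

theorem stmt_1 :
    ∃ C : ℝ, 0 < C ∧ ∀ (A : Finset ℝ) (M : ℝ),
      2 ≤ A.card → 1 ≤ M →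
      ((A * A).card : ℝ) ≤ M * (A.card : ℝ) →
      ((((A ×ˢ A ×ˢ A ×ˢ A).filter fun x =>
          x.1 + x.2.1 = x.2.2.1 + x.2.2.2).card : ℝ))
        ≤ C * M ^ ((8 : ℝ) / 5) * (A.card : ℝ) ^ ((49 : ℝ) / 20) *
            (Real.logb 2 (A.card : ℝ)) ^ ((1 : ℝ) / 5) := by
  have hC := one_le_energyConst
  refine ⟨5 + 16 * energyConst, by positivity, fun A M hA hM hAA => ?_⟩
  have hB : #A ≤ #(A.erase 0) + 1 := by
    have := pred_card_le_card_erase (s := A) (a := (0 : ℝ))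
    omega
  have hBA : #(A.erase 0) ≤ #A := card_erase_le
  have hn2 : (2 : ℝ) ≤ #A := by exact_mod_cast hA
  have hmul : (#(A.erase 0 * A.erase 0) : ℝ) ≤ (2 * M) * #(A.erase 0) := by
    have h1 : (#(A.erase 0 * A.erase 0) : ℝ) ≤ #(A * A) := by
      exact_mod_cast card_le_card (mul_subset_mul (erase_subset _ _) (erase_subset _ _))
    have h2 : (#A : ℝ) ≤ 2 * #(A.erase 0) := by
      have : #A ≤ 2 * #(A.erase 0) := by omega
      exact_mod_cast this
    calc _ ≤ M * (#A : ℝ) := h1.trans hAA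
      _ ≤ M * (2 * #(A.erase 0)) := by gcongr
      _ = _ := by ring
  have hE := energy_le_of_zero_notMem (card_pos.1 (by omega)) (notMem_erase 0 A)
    (by linarith : 1 ≤ 2 * M) hmul
  have hE' : (#{x ∈ A ×ˢ A ×ˢ A ×ˢ A | x.1 + x.2.1 = x.2.2.1 + x.2.2.2} : ℝ) ≤
      #{x ∈ A.erase 0 ×ˢ A.erase 0 ×ˢ A.erase 0 ×ˢ A.erase 0 |
        x.1 + x.2.1 = x.2.2.1 + x.2.2.2} + 4 * #A ^ 2 := by
    exact_mod_cast card_energy_le_erase_zero A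
  have hBA' : (#(A.erase 0) : ℝ) ≤ #A := by exact_mod_cast hBA
  have h2M : (2 * M) ^ (8 / 5 : ℝ) ≤ 4 * M ^ (8 / 5 : ℝ) := by
    rw [Real.mul_rpow (by norm_num) (by linarith)]
    gcongr
    calc (2 : ℝ) ^ (8 / 5 : ℝ) ≤ 2 ^ (2 : ℝ) :=
          Real.rpow_le_rpow_of_exponent_le (by norm_num) (by norm_num)
      _ = 4 := by norm_num
  have hsq : (#A : ℝ) ^ 2 ≤ M ^ (8 / 5 : ℝ) * (#A : ℝ) ^ (49 / 20 : ℝ) := by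
    have h1 : (#A : ℝ) ^ 2 ≤ (#A : ℝ) ^ (49 / 20 : ℝ) := by
      rw [← Real.rpow_natCast]
      exact Real.rpow_le_rpow_of_exponent_le (by linarith) (by norm_num)
    have h2 : 1 ≤ M ^ (8 / 5 : ℝ) := Real.one_le_rpow hM (by norm_num)
    nlinarith [sq_nonneg (#A : ℝ)]
  have hlog : 1 ≤ Real.logb 2 (#A : ℝ) ^ (1 / 5 : ℝ) := by
    refine Real.one_le_rpow ?_ (by norm_num)
    rw [Real.le_logb_iff_rpow_le (by norm_num) (by linarith), Real.rpow_one]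
    exact hn2
  calc _ ≤ _ := hE'
    _ ≤ #(A.erase 0) ^ 2 + 4 * energyConst * ((2 * M) ^ (8 / 5 : ℝ) *
        (#(A.erase 0) : ℝ) ^ (49 / 20 : ℝ)) + 4 * #A ^ 2 := by gcongr
    _ ≤ #A ^ 2 + 4 * energyConst * (4 * M ^ (8 / 5 : ℝ) * (#A : ℝ) ^ (49 / 20 : ℝ)) +
        4 * #A ^ 2 := by gcongr
    _ = 5 * #A ^ 2 + 16 * energyConst * (M ^ (8 / 5 : ℝ) * (#A : ℝ) ^ (49 / 20 : ℝ)) := by ring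
    _ ≤ 5 * (M ^ (8 / 5 : ℝ) * (#A : ℝ) ^ (49 / 20 : ℝ)) +
        16 * energyConst * (M ^ (8 / 5 : ℝ) * (#A : ℝ) ^ (49 / 20 : ℝ)) := by gcongr
    _ = (5 + 16 * energyConst) * M ^ (8 / 5 : ℝ) * (#A : ℝ) ^ (49 / 20 : ℝ) := by ring
    _ ≤ _ := le_mul_of_one_le_right (by positivity) hlog
end

section
/- There exist positive constants c, c′ and C such that the following holds: for any finite set X ⊆ ℝ with |X| ≥ 2 and |XX| ≤ |X|^(1+c), and any finite nonempty set B ⊆ ℝ, the quantity σ_X(B) := |{(b,b′,x) ∈ B × B × X : b + b′ = x}| satisfies σ_X(B) ≤ C · |B|^(17/10) · |X|^(3/20 − c′) · (log(|X|·|B|))^C. -/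
open Finset Pointwise

/-- The index of the block containing `x` when `B` is cut into blocks of `L` consecutive elements. -/
noncomputable def rankBlock (B : Finset ℝ) (L : ℕ) (x : ℝ) : ℕ := #{b ∈ B | b < x} / L

lemma rankBlock_mono (B : Finset ℝ) (L : ℕ) : Monotone (rankBlock B L) := fun _ _ hxy =>
  Nat.div_le_div_right <| card_le_card <|
    monotone_filter_right B fun _ _ hb => lt_of_lt_of_le hb hxy

lemma rankBlock_le (B : Finset ℝ) (L : ℕ) (x : ℝ) : rankBlock B L x ≤ #B / L :=
  Nat.div_le_div_right (card_filter_le _ _)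

lemma card_rankBlock_fiber_le (B : Finset ℝ) {L : ℕ} (hL : 0 < L) (i : ℕ) :
    #{b ∈ B | rankBlock B L b = i} ≤ L := by
  have hinj : ∀ x ∈ B, ∀ y, x < y → #{b ∈ B | b < x} < #{b ∈ B | b < y} := by
    intro x hx y hxy
    apply card_lt_card
    refine ⟨monotone_filter_right B fun _ _ hb => lt_trans hb hxy, fun h => ?_⟩
    have := h (mem_filter.2 ⟨hx, hxy⟩)
    simp at this
  calc #{b ∈ B | rankBlock B L b = i} ≤ #(Ico (i * L) (i * L + L)) := by
        refine card_le_card_of_injOn (fun x => #{b ∈ B | b < x}) ?_ ?_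
        · intro x hx
          have hx := (mem_filter.1 (mem_coe.1 hx)).2
          unfold rankBlock at hx
          simp only [coe_Ico, Set.mem_Ico]
          have h1 := Nat.div_mul_le_self #{b ∈ B | b < x} L
          have h2 := Nat.lt_div_mul_add (a := #{b ∈ B | b < x}) hL
          rw [hx] at h1 h2
          exact ⟨h1, h2⟩
        · intro x hx y hy hxy
          simp only [mem_coe, mem_filter] at hx hy
          rcases lt_trichotomy x y with h | h | h
          · exact absurd hxy (hinj x hx.1 y h).ne
          · exact h
          · exact absurd hxy (hinj y hy.1 x h).ne'
    _ = L := by simp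

lemma card_rankBlock_pairs_le (B : Finset ℝ) {L : ℕ} (hL : 0 < L) :
    #{x ∈ B ×ˢ B | rankBlock B L x.2 = rankBlock B L x.1} ≤ #B * L := by
  have h : ({x ∈ B ×ˢ B | rankBlock B L x.2 = rankBlock B L x.1} : Finset (ℝ × ℝ)).card
      ≤ L * #(image Prod.fst {x ∈ B ×ˢ B | rankBlock B L x.2 = rankBlock B L x.1}) := by
    refine card_le_mul_card_image _ _ fun a _ => ?_
    refine le_trans (card_le_card_of_injOn Prod.snd ?_ ?_)
      (card_rankBlock_fiber_le B hL (rankBlock B L a))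
    · rintro ⟨x, y⟩ h
      simp only [mem_coe, mem_filter, mem_product] at h ⊢
      obtain ⟨⟨⟨hx, hy⟩, h⟩, rfl⟩ := h
      exact ⟨hy, h⟩
    · rintro ⟨x, y⟩ h ⟨x', y'⟩ h' hh
      simp only [mem_coe, mem_filter] at h h' hh
      simp [h.2, h'.2, hh]
  refine h.trans ?_
  rw [mul_comm]
  gcongr
  intro a
  simp only [mem_image, mem_filter, mem_product]
  rintro ⟨x, hx, rfl⟩
  exact hx.1.1

lemma card_rankBlock_triples_le (B : Finset ℝ) {L : ℕ} (hL : 0 < L) :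
    #{x ∈ B ×ˢ B ×ˢ B | rankBlock B L x.2.1 = rankBlock B L x.1 ∧
      rankBlock B L x.2.2 = rankBlock B L x.1} ≤ #B * L * L := by
  have h : #{x ∈ B ×ˢ B ×ˢ B | rankBlock B L x.2.1 = rankBlock B L x.1 ∧
      rankBlock B L x.2.2 = rankBlock B L x.1} ≤
      L * #(image (fun x : ℝ × ℝ × ℝ => (x.1, x.2.1))
        {x ∈ B ×ˢ B ×ˢ B | rankBlock B L x.2.1 = rankBlock B L x.1 ∧
          rankBlock B L x.2.2 = rankBlock B L x.1}) := by
    refine card_le_mul_card_image _ _ fun a _ => ?_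
    refine le_trans (card_le_card_of_injOn (fun x => x.2.2) ?_ ?_)
      (card_rankBlock_fiber_le B hL (rankBlock B L a.1))
    · rintro ⟨x, y, z⟩ h
      simp only [mem_coe, mem_filter, mem_product] at h ⊢
      obtain ⟨⟨⟨hx, hy, hz⟩, h, h'⟩, rfl⟩ := h
      exact ⟨hz, h'⟩
    · rintro ⟨x, y, z⟩ h ⟨x', y', z'⟩ h' hh
      simp only [mem_coe, mem_filter] at h h' hh
      have := h.2.trans h'.2.symm
      simp only [Prod.mk.injEq] at this ⊢
      exact ⟨this.1, this.2, hh⟩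
  refine h.trans ?_
  rw [mul_comm]
  gcongr
  refine le_trans (card_le_card ?_) (card_rankBlock_pairs_le B hL)
  intro a
  simp only [mem_image, mem_filter, mem_product]
  rintro ⟨x, hx, rfl⟩
  exact ⟨⟨hx.1.1, hx.1.2.1⟩, hx.2.1⟩

lemma exists_median {α : Type*} (T : Finset α) (g : α → ℝ) :
    ∃ m : ℝ, #T ≤ 2 * #{t ∈ T | m ≤ g t} ∧ #T ≤ 2 * #{t ∈ T | g t ≤ m} := by
  rcases T.eq_empty_or_nonempty with rfl | hT
  · exact ⟨0, by simp, by simp⟩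
  obtain ⟨t₀, ht₀, hmax⟩ := T.exists_max_image g hT
  have hne : ({t ∈ T | #T ≤ 2 * #{x ∈ T | g x ≤ g t}} : Finset α).Nonempty := by
    refine ⟨t₀, mem_filter.2 ⟨ht₀, ?_⟩⟩
    rw [filter_true_of_mem hmax]
    omega
  obtain ⟨t, ht, hmin⟩ := exists_min_image _ g hne
  rw [mem_filter] at ht
  refine ⟨g t, ?_, ht.2⟩
  by_contra! hlt
  have hsum := card_filter_add_card_filter_not (s := T) (fun x => g t ≤ g x)
  have hne' : ({x ∈ T | ¬ g t ≤ g x} : Finset α).Nonempty := by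
    rw [← card_pos]; omega
  obtain ⟨u, hu, humax⟩ := exists_max_image _ g hne'
  rw [mem_filter, not_le] at hu
  refine absurd (hmin u (mem_filter.2 ⟨hu.1, ?_⟩)) (not_le.2 hu.2)
  have : #{x ∈ T | ¬ g t ≤ g x} ≤ #{x ∈ T | g x ≤ g u} :=
    card_le_card fun x hx => mem_filter.2 ⟨(mem_filter.1 hx).1, humax x hx⟩
  omega

lemma exists_successor (A : Finset ℝ) : ∃ s : ℝ → ℝ, ∀ a, (∃ x ∈ A, a < x) →
    a < s a ∧ s a ∈ A ∧ ∀ x ∈ A, a < x → s a ≤ x := by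
  have : ∀ a, ∃ y, (∃ x ∈ A, a < x) → a < y ∧ y ∈ A ∧ ∀ x ∈ A, a < x → y ≤ x := by
    intro a
    by_cases h : ∃ x ∈ A, a < x
    · obtain ⟨x, hx, hax⟩ := h
      obtain ⟨y, hy, hmin⟩ := exists_min_image {x ∈ A | a < x} id ⟨x, mem_filter.2 ⟨hx, hax⟩⟩
      rw [mem_filter] at hy
      exact ⟨y, fun _ => ⟨hy.2, hy.1, fun z hz haz => hmin z (mem_filter.2 ⟨hz, haz⟩)⟩⟩
    · exact ⟨0, fun h' => absurd h' h⟩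
  choose s hs using this
  exact ⟨s, hs⟩

/-- A typical gap `m` of the image of `A` under `v`: about half of the points of `A` have images that are
`m`-separated, while a similar number of pairs from `A` in the same block of `B` have images at
distance at most `m`. -/
lemma exists_median_gap {A : Finset ℝ} (B : Finset ℝ) {v : ℝ → ℝ} (hv : StrictMonoOn v A)
    (L : ℕ) :
    ∃ m : ℝ, (∃ H ⊆ A, #A ≤ 2 * #H + 1 ∧ ∀ a ∈ H, ∀ b ∈ H, a < b → m ≤ v b - v a) ∧
      #A ≤ 2 * #{x ∈ A ×ˢ A | x.1 < x.2 ∧ rankBlock B L x.2 = rankBlock B L x.1 ∧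
        v x.2 - v x.1 ≤ m} + 2 * (#B / L + 1) + 1 := by
  obtain ⟨s, hs⟩ := exists_successor A
  set A₀ := {a ∈ A | ∃ x ∈ A, a < x} with hA₀
  have hcard : #A ≤ #A₀ + 1 := by
    have h1 := card_filter_add_card_filter_not (s := A) (fun a => ∃ x ∈ A, a < x)
    have h2 : #{a ∈ A | ¬ ∃ x ∈ A, a < x} ≤ 1 := by
      refine card_le_one.2 fun a ha b hb => ?_
      simp only [mem_filter, not_exists, not_and, not_lt] at ha hb
      exact le_antisymm (hb.2 a ha.1) (ha.2 b hb.1)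
    rw [← hA₀] at h1
    omega
  obtain ⟨m, hhigh, hlow⟩ := exists_median A₀ (fun a => v (s a) - v a)
  refine ⟨m, ⟨{a ∈ A₀ | m ≤ v (s a) - v a}, ?_, by omega, ?_⟩, ?_⟩
  · exact (filter_subset _ _).trans (filter_subset _ _)
  · intro a ha b hb hab
    simp only [hA₀, mem_filter] at ha hb
    have h := hs a ha.1.2
    have := hv.monotoneOn h.2.1 hb.1.1 (h.2.2 b hb.1.1 hab)
    linarith [ha.2]
  · have h1 := card_filter_add_card_filter_not (s := {a ∈ A₀ | v (s a) - v a ≤ m})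
      (fun a => rankBlock B L (s a) = rankBlock B L a)
    have h2 : #{a ∈ {a ∈ A₀ | v (s a) - v a ≤ m} | rankBlock B L (s a) = rankBlock B L a} ≤
        #{x ∈ A ×ˢ A | x.1 < x.2 ∧ rankBlock B L x.2 = rankBlock B L x.1 ∧
        v x.2 - v x.1 ≤ m} := by
      refine card_le_card_of_injOn (fun a => (a, s a)) ?_ ?_
      · intro a ha
        simp only [hA₀, mem_coe, mem_filter, mem_product] at ha ⊢
        have h := hs a ha.1.1.2
        exact ⟨⟨ha.1.1.1, h.2.1⟩, h.1, ha.2, ha.1.2⟩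
      · intro a _ b _ h
        exact (Prod.mk.inj h).1
    have h3 : #{a ∈ {a ∈ A₀ | v (s a) - v a ≤ m} | ¬ rankBlock B L (s a) = rankBlock B L a} ≤
        #(range (#B / L + 1)) := by
      have key : ∀ a ∈ A₀, ¬ rankBlock B L (s a) = rankBlock B L a → ∀ b ∈ A, a < b →
          rankBlock B L a ≠ rankBlock B L b := by
        intro a ha hne b hb hab heq
        have h := hs a (mem_filter.1 ha).2
        refine hne (le_antisymm ?_ (rankBlock_mono B L h.1.le))
        rw [heq]
        exact rankBlock_mono B L (h.2.2 b hb hab)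
      refine card_le_card_of_injOn (rankBlock B L) ?_ ?_
      · intro a _
        simp only [coe_range, Set.mem_Iio]
        exact Nat.lt_succ_of_le (rankBlock_le B L a)
      · intro a ha b hb hab
        simp only [mem_coe, mem_filter] at ha hb
        rcases lt_trichotomy a b with h | h | h
        · exact absurd hab (key a ha.1.1 ha.2 b (mem_filter.1 hb.1.1).1 h)
        · exact h
        · exact absurd hab.symm (key b hb.1.1 hb.2 a (mem_filter.1 ha.1.1).1 h)
    rw [card_range] at h3
    omega

lemma card_mul_card_le_of_separated {H R D : Finset ℝ} {v : ℝ → ℝ} {m : ℝ}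
    (hsep : ∀ a ∈ H, ∀ b ∈ H, a < b → m ≤ v b - v a)
    (hR : ∀ r ∈ R, 0 < r ∧ r ≤ 2 * m) (hD : ∀ a ∈ H, ∀ r ∈ R, v a + r ∈ D) :
    #H * #R ≤ 2 * #D := by
  rw [← card_product]
  refine (card_le_mul_card_image (f := fun x : ℝ × ℝ => v x.1 + x.2) (H ×ˢ R) 2 ?_).trans ?_
  · intro y _
    by_contra! hlt
    obtain ⟨x₁, h₁, x₂, h₂, x₃, h₃, h₁₂, h₁₃, h₂₃⟩ := two_lt_card.1 hlt
    have key : ∀ x₁ ∈ ({x ∈ H ×ˢ R | v x.1 + x.2 = y} : Finset (ℝ × ℝ)),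
        ∀ x₂ ∈ ({x ∈ H ×ˢ R | v x.1 + x.2 = y} : Finset (ℝ × ℝ)),
        ∀ x₃ ∈ ({x ∈ H ×ˢ R | v x.1 + x.2 = y} : Finset (ℝ × ℝ)),
        x₁.1 < x₂.1 → x₂.1 < x₃.1 → False := by
      intro x₁ h₁ x₂ h₂ x₃ h₃ h h'
      simp only [mem_filter, mem_product] at h₁ h₂ h₃
      linarith [hsep _ h₁.1.1 _ h₂.1.1 h, hsep _ h₂.1.1 _ h₃.1.1 h', hR _ h₁.1.2, hR _ h₃.1.2]
    have hne : ∀ x₁ ∈ ({x ∈ H ×ˢ R | v x.1 + x.2 = y} : Finset (ℝ × ℝ)),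
        ∀ x₂ ∈ ({x ∈ H ×ˢ R | v x.1 + x.2 = y} : Finset (ℝ × ℝ)), x₁ ≠ x₂ → x₁.1 ≠ x₂.1 := by
      intro x₁ h₁ x₂ h₂ hne heq
      simp only [mem_filter, mem_product] at h₁ h₂
      refine hne (Prod.ext heq ?_)
      have := h₁.2.trans h₂.2.symm
      rw [heq] at this
      linarith
    rcases lt_or_gt_of_ne (hne _ h₁ _ h₂ h₁₂) with h | h <;>
    rcases lt_or_gt_of_ne (hne _ h₂ _ h₃ h₂₃) with h' | h' <;>
    rcases lt_or_gt_of_ne (hne _ h₁ _ h₃ h₁₃) with h'' | h'' <;>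
    first
      | exact key _ h₁ _ h₂ _ h₃ ‹_› ‹_›
      | exact key _ h₁ _ h₃ _ h₂ ‹_› ‹_›
      | exact key _ h₂ _ h₁ _ h₃ ‹_› ‹_›
      | exact key _ h₂ _ h₃ _ h₁ ‹_› ‹_›
      | exact key _ h₃ _ h₁ _ h₂ ‹_› ‹_›
      | exact key _ h₃ _ h₂ _ h₁ ‹_› ‹_›
  · gcongr
    intro y
    simp only [mem_image, mem_product]
    rintro ⟨x, hx, rfl⟩
    exact hD _ hx.1 _ hx.2

lemma card_le_card_triples_add {α β : Type*} [DecidableEq α] [DecidableEq β] (Z : Finset α)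
    (κ : α → β) :
    #Z ≤ #{x ∈ Z ×ˢ Z ×ˢ Z | (x.1 ≠ x.2.1 ∧ x.1 ≠ x.2.2 ∧ x.2.1 ≠ x.2.2) ∧
      κ x.2.1 = κ x.1 ∧ κ x.2.2 = κ x.1} + 2 * #(image κ Z) := by
  set T := {x ∈ Z ×ˢ Z ×ˢ Z | (x.1 ≠ x.2.1 ∧ x.1 ≠ x.2.2 ∧ x.2.1 ≠ x.2.2) ∧
      κ x.2.1 = κ x.1 ∧ κ x.2.2 = κ x.1} with hT
  have h1 : #Z = ∑ y ∈ image κ Z, #{z ∈ Z | κ z = y} :=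
    card_eq_sum_card_fiberwise fun z hz => mem_coe.2 (mem_image_of_mem κ hz)
  have h2 : #T = ∑ y ∈ image κ Z, #{x ∈ T | κ x.1 = y} := by
    refine card_eq_sum_card_fiberwise fun x hx => ?_
    simp only [hT, mem_coe, mem_filter, mem_product] at hx
    exact mem_coe.2 (mem_image_of_mem κ hx.1.1)
  have h3 : ∀ y ∈ image κ Z, #{z ∈ Z | κ z = y} ≤ #{x ∈ T | κ x.1 = y} + 2 := by
    intro y _
    rcases le_or_gt #{z ∈ Z | κ z = y} 1 with h | h
    · omega
    obtain ⟨a, ha, b, hb, hab⟩ := one_lt_card.1 h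
    have h4 : #(({z ∈ Z | κ z = y} \ {a, b} : Finset α)) ≤ #{x ∈ T | κ x.1 = y} := by
      refine card_le_card_of_injOn (fun z => (z, a, b)) ?_ ?_
      · intro z hz
        simp only [hT, mem_coe, mem_filter, mem_product, mem_sdiff, mem_insert, mem_singleton,
          not_or] at hz ha hb ⊢
        exact ⟨⟨⟨hz.1.1, ha.1, hb.1⟩, ⟨hz.2.1, hz.2.2, hab⟩, ha.2.trans hz.1.2.symm,
          hb.2.trans hz.1.2.symm⟩, hz.1.2⟩
      · intro z _ w _ hzw
        exact (Prod.mk.inj hzw).1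
    have h5 := le_card_sdiff ({a, b} : Finset α) {z ∈ Z | κ z = y}
    have h6 := card_le_two (a := a) (b := b)
    omega
  calc #Z ≤ ∑ y ∈ image κ Z, (#{x ∈ T | κ x.1 = y} + 2) := h1 ▸ sum_le_sum h3
    _ = #T + 2 * #(image κ Z) := by
      rw [sum_add_distrib, ← h2, sum_const, smul_eq_mul, mul_comm]

lemma card_image_cells_le {B R Z : Finset ℝ} {f : ℝ → ℝ} (hf : AntitoneOn f Z) (k l : ℕ) :
    #(image (fun z => (rankBlock B k z, rankBlock R l (f z))) Z) ≤ #B / k + #R / l + 1 := by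
  rw [← card_range (#B / k + #R / l + 1)]
  have key : ∀ z ∈ Z, ∀ w ∈ Z, z ≤ w → rankBlock B k z ≤ rankBlock B k w ∧
      rankBlock R l (f w) ≤ rankBlock R l (f z) := fun z hz w hw h =>
    ⟨rankBlock_mono B k h, rankBlock_mono R l (hf hz hw h)⟩
  refine card_le_card_of_injOn (fun c => c.1 + (#R / l - c.2)) ?_ ?_
  · intro c hc
    obtain ⟨z, -, rfl⟩ := mem_image.1 (mem_coe.1 hc)
    have h1 := rankBlock_le B k z
    have h2 := rankBlock_le R l (f z)
    simp only [coe_range, Set.mem_Iio]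
    omega
  · intro c hc c' hc' h
    obtain ⟨z, hz, rfl⟩ := mem_image.1 (mem_coe.1 hc)
    obtain ⟨w, hw, rfl⟩ := mem_image.1 (mem_coe.1 hc')
    have h1 := rankBlock_le R l (f z)
    have h2 := rankBlock_le R l (f w)
    simp only [Prod.mk.injEq] at h ⊢
    rcases le_total z w with hzw | hzw
    · have := key z hz w hw hzw
      omega
    · have := key w hw z hz hzw
      omega

lemma exp_mul_mobius_eq {p q d p' q' d' z : ℝ} (hpq : p < q) (hpq' : p' < q') (hp : 0 < p + z)
    (hp' : 0 < p' + z)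
    (h : Real.log (q + z) - Real.log (p + z) + d = Real.log (q' + z) - Real.log (p' + z) + d') :
    Real.exp d * ((q + z) * (p' + z)) = Real.exp d' * ((q' + z) * (p + z)) := by
  have hq : 0 < q + z := by linarith
  have hq' : 0 < q' + z := by linarith
  have h' : d + (Real.log (q + z) + Real.log (p' + z)) =
      d' + (Real.log (q' + z) + Real.log (p + z)) := by linarith
  have := congrArg Real.exp h'
  simpa only [Real.exp_add, Real.exp_log hq, Real.exp_log hp, Real.exp_log hq',
    Real.exp_log hp'] using this

lemma quadratic_eq_zero {a b c x y z : ℝ} (hxy : x ≠ y) (hxz : x ≠ z) (hyz : y ≠ z)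
    (hx : a * x ^ 2 + b * x + c = 0) (hy : a * y ^ 2 + b * y + c = 0)
    (hz : a * z ^ 2 + b * z + c = 0) : a = 0 ∧ b = 0 ∧ c = 0 := by
  have h1 : a * (x + y) + b = 0 := by
    apply mul_left_cancel₀ (sub_ne_zero.2 hxy)
    linear_combination hx - hy
  have h2 : a * (x + z) + b = 0 := by
    apply mul_left_cancel₀ (sub_ne_zero.2 hxz)
    linear_combination hx - hz
  have ha : a = 0 := by
    apply mul_left_cancel₀ (sub_ne_zero.2 hyz)
    linear_combination h1 - h2
  subst ha
  have hb : b = 0 := by linear_combination h1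
  subst hb
  exact ⟨rfl, rfl, by linear_combination hx⟩

lemma log_mobius_injective {p q d p' q' d' x y z : ℝ} (hpq' : p' < q')
    (hxy : x ≠ y) (hxz : x ≠ z) (hyz : y ≠ z)
    (hx : Real.exp d * ((q + x) * (p' + x)) = Real.exp d' * ((q' + x) * (p + x)))
    (hy : Real.exp d * ((q + y) * (p' + y)) = Real.exp d' * ((q' + y) * (p + y)))
    (hz : Real.exp d * ((q + z) * (p' + z)) = Real.exp d' * ((q' + z) * (p + z))) :
    p = p' ∧ q = q' ∧ d = d' := by
  set E := Real.exp d with hE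
  set E' := Real.exp d' with hE'
  obtain ⟨ha, hb, hc⟩ := quadratic_eq_zero (a := E - E')
    (b := E * (q + p') - E' * (q' + p)) (c := E * (q * p') - E' * (q' * p)) hxy hxz hyz
    (by linear_combination hx) (by linear_combination hy) (by linear_combination hz)
  have hEE : E = E' := sub_eq_zero.1 ha
  have hpos : E' ≠ 0 := (Real.exp_pos d').ne'
  rw [hEE] at hb hc
  have hb' : q + p' - (q' + p) = 0 := by
    apply mul_left_cancel₀ hpos
    linear_combination hb
  have hc' : q * p' - q' * p = 0 := by
    apply mul_left_cancel₀ hpos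
    linear_combination hc
  have hp : p = p' := by
    apply mul_left_cancel₀ (sub_ne_zero.2 hpq'.ne')
    linear_combination -hc' + p' * hb'
  exact ⟨hp, by linear_combination hb' + hp, Real.exp_injective hEE⟩

lemma log_mobius_strictAntiOn {p q : ℝ} (d : ℝ) (hpq : p < q) :
    StrictAntiOn (fun z => Real.log (q + z) - Real.log (p + z) + d) {z | 0 < p + z} := by
  intro z hz w hw hzw
  simp only [Set.mem_ofPred_eq] at hz hw
  have h : Real.log ((q + w) * (p + z)) < Real.log ((q + z) * (p + w)) :=
    Real.log_lt_log (mul_pos (by linarith) hz) (by nlinarith)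
  rw [Real.log_mul (by linarith) hz.ne', Real.log_mul (by linarith) hw.ne'] at h
  simp only
  linarith

/-- An incidence bound for the curves `w = log ((q + z) / (p + z)) + d` and the points of the
grid `B × R`, where each curve `(p, q, d)` is incident to many points. -/
lemma sum_card_incidences_le {B R : Finset ℝ} {C : Finset (ℝ × ℝ × ℝ)}
    {Z : ℝ × ℝ × ℝ → Finset ℝ} {k l : ℕ} (hk : 0 < k) (hl : 0 < l)
    (hlt : ∀ c ∈ C, c.1 < c.2.1) (hZB : ∀ c ∈ C, Z c ⊆ B)
    (hpos : ∀ c ∈ C, ∀ z ∈ Z c, 0 < c.1 + z)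
    (hR : ∀ c ∈ C, ∀ z ∈ Z c, Real.log (c.2.1 + z) - Real.log (c.1 + z) + c.2.2 ∈ R)
    (hrich : ∀ c ∈ C, 4 * (#B / k + #R / l + 1) ≤ #(Z c)) :
    ∑ c ∈ C, #(Z c) ≤ 2 * ((#B * k * k) * (#R * l * l)) := by
  let f : ℝ × ℝ × ℝ → ℝ → ℝ := fun c z => Real.log (c.2.1 + z) - Real.log (c.1 + z) + c.2.2
  let κ : ℝ × ℝ × ℝ → ℝ → ℕ × ℕ := fun c z => (rankBlock B k z, rankBlock R l (f c z))
  let T : ℝ × ℝ × ℝ → Finset (ℝ × ℝ × ℝ) := fun c =>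
    {x ∈ Z c ×ˢ Z c ×ˢ Z c | (x.1 ≠ x.2.1 ∧ x.1 ≠ x.2.2 ∧ x.2.1 ≠ x.2.2) ∧
      κ c x.2.1 = κ c x.1 ∧ κ c x.2.2 = κ c x.1}
  have hT : ∀ c ∈ C, #(Z c) ≤ 2 * #(T c) := by
    intro c hc
    have h1 : #(Z c) ≤ #(T c) + 2 * #(image (κ c) (Z c)) := card_le_card_triples_add (Z c) (κ c)
    have h2 : #(image (κ c) (Z c)) ≤ #B / k + #R / l + 1 :=
      card_image_cells_le (((log_mobius_strictAntiOn c.2.2 (hlt c hc)).antitoneOn).mono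
        fun z hz => hpos c hc z hz) k l
    have h3 := hrich c hc
    omega
  refine (sum_le_sum hT).trans ?_
  rw [← mul_sum, ← card_sigma]
  refine Nat.mul_le_mul_left 2 (le_trans ?_ (Nat.mul_le_mul
    (card_rankBlock_triples_le B hk) (card_rankBlock_triples_le R hl)))
  rw [← card_product]
  refine card_le_card_of_injOn
    (fun x => (x.2, (f x.1 x.2.1, f x.1 x.2.2.1, f x.1 x.2.2.2))) ?_ ?_
  · rintro ⟨c, x, y, z⟩ h
    simp only [T, κ, mem_coe, mem_sigma, mem_filter, mem_product, Prod.mk.injEq] at h ⊢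
    obtain ⟨hc, ⟨hx, hy, hz⟩, -, h1, h2⟩ := h
    exact ⟨⟨⟨hZB c hc hx, hZB c hc hy, hZB c hc hz⟩, h1.1, h2.1⟩,
      ⟨hR c hc x hx, hR c hc y hy, hR c hc z hz⟩, h1.2, h2.2⟩
  · rintro ⟨⟨p, q, d⟩, x, y, z⟩ h ⟨⟨p', q', d'⟩, x', y', z'⟩ h' heq
    simp only [T, f, mem_coe, mem_sigma, mem_filter, mem_product, Prod.mk.injEq] at h h' heq
    obtain ⟨⟨rfl, rfl, rfl⟩, hx, hy, hz⟩ := heq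
    obtain ⟨hc, ⟨mx, my, mz⟩, ⟨hxy, hxz, hyz⟩, -⟩ := h
    obtain ⟨hc', ⟨mx', my', mz'⟩, -⟩ := h'
    have hpq := hlt _ hc
    have hpq' := hlt _ hc'
    obtain ⟨rfl, rfl, rfl⟩ := log_mobius_injective hpq' hxy hxz hyz
      (exp_mul_mobius_eq hpq hpq' (hpos _ hc _ mx) (hpos _ hc' _ mx') hx)
      (exp_mul_mobius_eq hpq hpq' (hpos _ hc _ my) (hpos _ hc' _ my') hy)
      (exp_mul_mobius_eq hpq hpq' (hpos _ hc _ mz) (hpos _ hc' _ mz') hz)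
    rfl

/-- The pairs in `B × B` with a positive sum whose logarithm lies in `Y`. -/
noncomputable def logSumPairs (B Y : Finset ℝ) : Finset (ℝ × ℝ) :=
  {x ∈ B ×ˢ B | 0 < x.1 + x.2 ∧ Real.log (x.1 + x.2) ∈ Y}

/-- Pairs of points `((p, q), z)` such that `p < q` lie in the same block of `B` and both
`log (p + z)` and `log (q + z)` lie in `Y`, at distance at most `m`. -/
noncomputable def shortGaps (B Y : Finset ℝ) (L : ℕ) (m : ℝ) : Finset ((ℝ × ℝ) × ℝ) :=
  {x ∈ (B ×ˢ B) ×ˢ B | (x.1.1 < x.1.2 ∧ rankBlock B L x.1.2 = rankBlock B L x.1.1) ∧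
    0 < x.1.1 + x.2 ∧ (Real.log (x.1.1 + x.2) ∈ Y ∧ Real.log (x.1.2 + x.2) ∈ Y) ∧
    Real.log (x.1.2 + x.2) - Real.log (x.1.1 + x.2) ≤ m}

lemma exists_card_le_shortGaps {B Y : Finset ℝ} {L : ℕ}
    (hpos : 0 < #(logSumPairs B Y))
    (hL : 2 * #B * (4 * (#B / L) + 6) ≤ #(logSumPairs B Y)) :
    ∃ m : ℝ, #(logSumPairs B Y) ≤ 8 * #(shortGaps B Y L m) ∧
      ∃ (z : ℝ) (H : Finset ℝ), #(logSumPairs B Y) ≤ 8 * #B * #H ∧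
        (∀ a ∈ H, Real.log (a + z) ∈ Y) ∧
        ∀ a ∈ H, ∀ b ∈ H, a < b → m ≤ Real.log (b + z) - Real.log (a + z) := by
  set P := logSumPairs B Y with hP
  let A : ℝ → Finset ℝ := fun z => {a ∈ B | 0 < a + z ∧ Real.log (a + z) ∈ Y}
  have hsum : #P = ∑ z ∈ B, #(A z) := by
    have h1 : #P = ∑ z ∈ B, #{x ∈ P | x.2 = z} := by
      refine card_eq_sum_card_fiberwise fun x hx => ?_
      simp only [hP, logSumPairs, mem_coe, mem_filter, mem_product] at hx ⊢
      exact hx.1.2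
    rw [h1]
    refine sum_congr rfl fun z hz => ?_
    refine card_bij' (fun x _ => x.1) (fun a _ => (a, z)) ?_ ?_ ?_ ?_
    · rintro ⟨a, w⟩ h
      simp only [hP, A, logSumPairs, mem_filter, mem_product] at h ⊢
      obtain ⟨h, rfl⟩ := h
      exact ⟨h.1.1, h.2⟩
    · intro a h
      simp only [hP, A, logSumPairs, mem_filter, mem_product] at h ⊢
      exact ⟨⟨⟨h.1, hz⟩, h.2⟩, trivial⟩
    · rintro ⟨a, w⟩ h
      exact Prod.ext rfl (mem_filter.1 h).2.symm
    · intro a _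
      rfl
  have hB : 0 < #B := by
    rw [card_pos]
    by_contra h
    rw [not_nonempty_iff_eq_empty] at h
    simp [hsum, h] at hpos
  set G := {z ∈ B | #P ≤ 2 * #B * #(A z)} with hG
  have hGsum : #P ≤ 2 * ∑ z ∈ G, #(A z) := by
    have h1 := sum_filter_add_sum_filter_not B (fun z => #P ≤ 2 * #B * #(A z)) (fun z => #(A z))
    rw [← hG, ← hsum] at h1
    have h2 : 2 * #B * ∑ z ∈ B with ¬ #P ≤ 2 * #B * #(A z), #(A z) ≤ #B * #P := by
      rw [mul_sum, ← smul_eq_mul #B]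
      refine (sum_le_card_nsmul _ _ #P fun z hz => ?_).trans ?_
      · exact (not_le.1 (mem_filter.1 hz).2).le
      · exact Nat.mul_le_mul_right _ (card_filter_le _ _)
    have h3 : 2 * ∑ z ∈ B with ¬ #P ≤ 2 * #B * #(A z), #(A z) ≤ #P := by
      refine Nat.le_of_mul_le_mul_left ?_ hB
      linarith
    omega
  have hAbig : ∀ z ∈ G, 4 * (#B / L) + 6 ≤ #(A z) := fun z hz =>
    Nat.le_of_mul_le_mul_left (hL.trans (mem_filter.1 hz).2) (by omega)
  have hv : ∀ z, StrictMonoOn (fun a => Real.log (a + z)) (A z) := by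
    intro z a ha b _ hab
    simp only [A, mem_coe, mem_filter] at ha
    exact Real.log_lt_log ha.2.1 (by linarith)
  choose m hm using fun z => exists_median_gap B (hv z) L
  have hGne : G.Nonempty := by
    by_contra h
    rw [not_nonempty_iff_eq_empty] at h
    rw [h, sum_empty] at hGsum
    omega
  obtain ⟨z, hz, hmax⟩ := exists_max_image G m hGne
  refine ⟨m z, ?_, z, ?_⟩
  · have hlow : ∀ w ∈ G, #(A w) ≤ 4 * #{x ∈ shortGaps B Y L (m z) | x.2 = w} := by
      intro w hw
      have h1 := (hm w).2
      have h2 := hAbig w hw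
      have h3 : #{x ∈ A w ×ˢ A w | x.1 < x.2 ∧ rankBlock B L x.2 = rankBlock B L x.1 ∧
          Real.log (x.2 + w) - Real.log (x.1 + w) ≤ m w} ≤
          #{x ∈ shortGaps B Y L (m z) | x.2 = w} := by
        refine card_le_card_of_injOn (fun x => (x, w)) ?_ ?_
        · rintro ⟨p, q⟩ h
          simp only [A, shortGaps, mem_coe, mem_filter, mem_product] at h ⊢
          obtain ⟨⟨⟨hp, hp0, hpY⟩, hq, -, hqY⟩, hpq, hblk, hle⟩ := h
          exact ⟨⟨⟨⟨hp, hq⟩, (mem_filter.1 hw).1⟩, ⟨hpq, hblk⟩, hp0, ⟨hpY, hqY⟩,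
            hle.trans (hmax w hw)⟩, trivial⟩
        · intro x _ y _ hxy
          exact (Prod.mk.inj hxy).1
      omega
    have h4 : ∑ w ∈ G, #{x ∈ shortGaps B Y L (m z) | x.2 = w} ≤ #(shortGaps B Y L (m z)) := by
      rw [← card_biUnion]
      · exact card_le_card (biUnion_subset.2 fun w _ => filter_subset _ _)
      · intro w _ w' _ hne
        refine disjoint_left.2 fun x hx hx' => hne ?_
        exact (mem_filter.1 hx).2.symm.trans (mem_filter.1 hx').2
    have h5 := sum_le_sum hlow
    rw [← mul_sum] at h5
    omega
  · obtain ⟨H, hHA, hH, hsep⟩ := (hm z).1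
    refine ⟨H, ?_, fun a ha => (mem_filter.1 (hHA ha)).2.2, hsep⟩
    have h1 := hAbig z hz
    calc #P ≤ 2 * #B * #(A z) := (mem_filter.1 hz).2
      _ ≤ 2 * #B * (4 * #H) := Nat.mul_le_mul_left _ (by omega)
      _ = 8 * #B * #H := by ring

lemma pow_mul_card_shortGaps_le {B Y H : Finset ℝ} {L t : ℕ} {m z₀ : ℝ} (hL : 0 < L)
    (ht : 8 ≤ t) (hpos : 0 < #(shortGaps B Y L m))
    (hJ : 2 * (#B * L * t) ≤ #(shortGaps B Y L m))
    (hHY : ∀ a ∈ H, Real.log (a + z₀) ∈ Y)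
    (hsep : ∀ a ∈ H, ∀ b ∈ H, a < b → m ≤ Real.log (b + z₀) - Real.log (a + z₀)) :
    ∃ r : ℕ, #H * r ≤ 2 * #(3 • Y - 2 • Y) ∧
      t ^ 5 * #(shortGaps B Y L m) ≤ 4 * 17 ^ 4 * (#B * r) ^ 3 := by
  set J := shortGaps B Y L m with hJdef
  have hmem : ∀ x ∈ J, ((x.1.1 ∈ B ∧ x.1.2 ∈ B) ∧ x.2 ∈ B) ∧
      (x.1.1 < x.1.2 ∧ rankBlock B L x.1.2 = rankBlock B L x.1.1) ∧
      0 < x.1.1 + x.2 ∧ (Real.log (x.1.1 + x.2) ∈ Y ∧ Real.log (x.1.2 + x.2) ∈ Y) ∧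
      Real.log (x.1.2 + x.2) - Real.log (x.1.1 + x.2) ≤ m := by
    intro x hx
    simpa only [hJdef, shortGaps, mem_filter, mem_product] using hx
  set S := image (fun x : (ℝ × ℝ) × ℝ => Real.log (x.1.2 + x.2) - Real.log (x.1.1 + x.2)) J
    with hS
  have hSm : ∀ s ∈ S, 0 < s ∧ s ≤ m := by
    intro s hs
    obtain ⟨x, hx, rfl⟩ := mem_image.1 hs
    have h := hmem x hx
    exact ⟨sub_pos.2 (Real.log_lt_log h.2.2.1 (by linarith [h.2.1.1])), h.2.2.2.2⟩
  have hSY : S ⊆ Y - Y := by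
    intro s hs
    obtain ⟨x, hx, rfl⟩ := mem_image.1 hs
    have h := hmem x hx
    exact sub_mem_sub h.2.2.2.1.2 h.2.2.2.1.1
  refine ⟨#(S + S), ?_, ?_⟩
  · refine card_mul_card_le_of_separated hsep ?_ ?_
    · intro r hr
      obtain ⟨s, hs, s', hs', rfl⟩ := mem_add.1 hr
      have h1 := hSm s hs
      have h2 := hSm s' hs'
      constructor <;> linarith
    · intro a ha r hr
      have h1 : Real.log (a + z₀) + r ∈ Y + ((Y - Y) + (Y - Y)) :=
        add_mem_add (hHY a ha) (add_subset_add hSY hSY hr)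
      have h2 : Y + ((Y - Y) + (Y - Y)) = 3 • Y - 2 • Y := by
        rw [sub_eq_add_neg, sub_eq_add_neg, succ_nsmul, two_nsmul, neg_add]
        ac_rfl
      rwa [h2] at h1
  set r := #(S + S) with hr
  set I := image Prod.fst J with hI
  let Z : ℝ × ℝ → Finset ℝ := fun i => image Prod.snd {x ∈ J | x.1 = i}
  have hZmem : ∀ i z, z ∈ Z i ↔ (i, z) ∈ J := by
    intro i z
    simp [Z]
  have hZcard : ∀ i, #(Z i) = #{x ∈ J | x.1 = i} := by
    intro i
    refine card_image_of_injOn ?_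
    intro x hx y hy hxy
    rw [mem_coe, mem_filter] at hx hy
    exact Prod.ext (hx.2.trans hy.2.symm) hxy
  have hIcard : #I ≤ #B * L := by
    refine le_trans (card_le_card ?_) (card_rankBlock_pairs_le B hL)
    intro i hi
    obtain ⟨x, hx, rfl⟩ := mem_image.1 hi
    have h := hmem x hx
    exact mem_filter.2 ⟨mem_product.2 h.1.1, h.2.1.2⟩
  have hJsum : #J = ∑ i ∈ I, #(Z i) := by
    simp_rw [hZcard]
    exact card_eq_sum_card_fiberwise fun x hx => mem_coe.2 (mem_image_of_mem _ hx)
  set I' := {i ∈ I | t ≤ #(Z i)} with hI'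
  have hrichsum : #J ≤ 2 * ∑ i ∈ I', #(Z i) := by
    have h1 := sum_filter_add_sum_filter_not I (fun i => t ≤ #(Z i)) (fun i => #(Z i))
    rw [← hI', ← hJsum] at h1
    have h2 : ∑ i ∈ I with ¬ t ≤ #(Z i), #(Z i) ≤ #B * L * t := by
      refine (sum_le_card_nsmul _ _ t fun i hi => (not_le.1 (mem_filter.1 hi).2).le).trans ?_
      exact Nat.mul_le_mul_right _ ((card_filter_le _ _).trans hIcard)
    omega
  have hne : I'.Nonempty := by
    by_contra h
    rw [not_nonempty_iff_eq_empty] at h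
    rw [h, sum_empty] at hrichsum
    omega
  obtain ⟨i₀, hi₀⟩ := hne
  have hti₀ : t ≤ #(Z i₀) := (mem_filter.1 hi₀).2
  have hZB : ∀ i, Z i ⊆ B := fun i z hz => (hmem _ ((hZmem i z).1 hz)).1.2
  have htS : t ≤ #S := by
    refine hti₀.trans (card_le_card_of_injOn
      (fun z => Real.log (i₀.2 + z) - Real.log (i₀.1 + z) + 0) ?_ ?_)
    · intro z hz
      rw [mem_coe, hZmem] at hz
      simp only [add_zero, mem_coe]
      exact mem_image_of_mem
        (fun x : (ℝ × ℝ) × ℝ => Real.log (x.1.2 + x.2) - Real.log (x.1.1 + x.2)) hz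
    · obtain ⟨z, hz⟩ := card_pos.1 (lt_of_lt_of_le (by omega) hti₀)
      refine ((log_mobius_strictAntiOn 0 (hmem _ ((hZmem _ _).1 hz)).2.1.1).mono ?_).injOn
      intro w hw
      exact (hmem _ ((hZmem _ _).1 hw)).2.2.1
  have htB : t ≤ #B := hti₀.trans (card_le_card (hZB i₀))
  have htr : t ≤ r := by
    obtain ⟨s, hs⟩ := card_pos.1 (lt_of_lt_of_le (by omega) htS)
    exact htS.trans (card_le_card_add_right ⟨s, hs⟩)
  have hdiv : ∀ a : ℕ, t ≤ a → 16 * (a / (16 * a / t + 1)) ≤ t ∧ (16 * a / t + 1) * t ≤ 17 * a := by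
    intro a ha
    have h1 := Nat.div_mul_le_self (16 * a) t
    have h2 := Nat.lt_div_mul_add (a := 16 * a) (b := t) (by omega)
    have h3 := Nat.div_mul_le_self a (16 * a / t + 1)
    refine ⟨?_, by nlinarith⟩
    refine le_of_mul_le_mul_right (a := 16 * a / t + 1) ?_ (Nat.succ_pos _)
    nlinarith
  obtain ⟨hk, hkt⟩ := hdiv #B htB
  obtain ⟨hl, hlt⟩ := hdiv r htr
  set k := 16 * #B / t + 1 with hkdef
  set l := 16 * r / t + 1 with hldef
  have hmain := sum_card_incidences_le (B := B) (R := S + S) (k := k) (l := l)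
    (C := (I' ×ˢ S).image fun c => (c.1.1, c.1.2, c.2)) (Z := fun c => Z (c.1, c.2.1))
    (Nat.succ_pos _) (Nat.succ_pos _) ?_ ?_ ?_ ?_ ?_
  · rw [sum_image] at hmain
    · simp only [Prod.mk.eta] at hmain
      rw [sum_product] at hmain
      simp only [sum_const, smul_eq_mul] at hmain
      rw [← mul_sum] at hmain
      have h1 : t * #J ≤ 2 * (2 * ((#B * k * k) * (r * l * l))) :=
        calc t * #J ≤ #S * (2 * ∑ i ∈ I', #(Z i)) := Nat.mul_le_mul htS hrichsum
          _ = 2 * (#S * ∑ i ∈ I', #(Z i)) := by ring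
          _ ≤ _ := Nat.mul_le_mul_left 2 hmain
      calc t ^ 5 * #J = t ^ 4 * (t * #J) := by ring
        _ ≤ t ^ 4 * (2 * (2 * ((#B * k * k) * (r * l * l)))) := Nat.mul_le_mul_left _ h1
        _ = 4 * (#B * r) * ((k * t) ^ 2 * (l * t) ^ 2) := by ring
        _ ≤ 4 * (#B * r) * ((17 * #B) ^ 2 * (17 * r) ^ 2) := by gcongr
        _ = _ := by ring
    · rintro ⟨⟨p, q⟩, d⟩ _ ⟨⟨p', q'⟩, d'⟩ _ h
      simp only [Prod.mk.injEq] at h ⊢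
      exact ⟨⟨h.1, h.2.1⟩, h.2.2⟩
  · intro c hc
    obtain ⟨c', hc', rfl⟩ := mem_image.1 hc
    obtain ⟨x, hx, hxc⟩ := mem_image.1 (mem_filter.1 (mem_product.1 hc').1).1
    rw [← hxc]
    exact (hmem x hx).2.1.1
  · exact fun c _ => hZB _
  · intro c _ z hz
    exact (hmem _ ((hZmem _ _).1 hz)).2.2.1
  · intro c hc z hz
    obtain ⟨c', hc', rfl⟩ := mem_image.1 hc
    exact add_mem_add (mem_image_of_mem
      (fun x : (ℝ × ℝ) × ℝ => Real.log (x.1.2 + x.2) - Real.log (x.1.1 + x.2))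
      ((hZmem _ _).1 hz)) (mem_product.1 hc').2
  · intro c hc
    obtain ⟨c', hc', rfl⟩ := mem_image.1 hc
    have := (mem_filter.1 (mem_product.1 hc').1).2
    simp only [Prod.mk.eta]
    rw [← hr]
    omega

theorem card_logSumPairs_pow_le (B Y : Finset ℝ) :
    #(logSumPairs B Y) ^ 14 ≤ 10 ^ 28 * #B ^ 21 * #(3 • Y - 2 • Y) ^ 3 := by
  set p := #(logSumPairs B Y) with hp
  set n := #B with hn
  set Q := #(3 • Y - 2 • Y) with hQ
  rcases Nat.eq_zero_or_pos p with h0 | hppos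
  · simp [h0]
  have hpn : p ≤ n ^ 2 := by
    rw [sq, hn, ← card_product]
    exact card_filter_le _ _
  have hnpos : 0 < n := by
    rcases Nat.eq_zero_or_pos n with h | h
    · simp [h] at hpn; omega
    · exact h
  have hQpos : 0 < Q := by
    obtain ⟨x, hx⟩ := card_pos.1 hppos
    have hY : Y.Nonempty := ⟨_, (mem_filter.1 hx).2.2⟩
    exact card_pos.2 (hY.nsmul.sub hY.nsmul)
  rcases lt_or_ge (p ^ 2) (8320 * n ^ 3) with hsmall | hbig
  · calc p ^ 14 = (p ^ 2) ^ 7 := by ring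
      _ ≤ (8320 * n ^ 3) ^ 7 := by gcongr
      _ = 8320 ^ 7 * n ^ 21 * 1 := by ring
      _ ≤ 10 ^ 28 * n ^ 21 * Q ^ 3 :=
        Nat.mul_le_mul (Nat.mul_le_mul_right _ (by norm_num)) (Nat.one_le_pow _ _ hQpos)
  have hpn16 : 16 * n ≤ p := by
    have : (16 * n) ^ 2 ≤ p ^ 2 := by nlinarith [Nat.mul_le_mul_left (n ^ 2) hnpos]
    exact (Nat.pow_le_pow_iff_left two_ne_zero).1 this
  set L := 64 * n ^ 2 / p + 1 with hL
  have hLp : L * p ≤ 65 * n ^ 2 := by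
    have := Nat.div_mul_le_self (64 * n ^ 2) p
    nlinarith
  have hLp' : 64 * n ^ 2 ≤ L * p := by
    have := Nat.lt_div_mul_add (a := 64 * n ^ 2) hppos
    nlinarith
  have hnL : 64 * n * (n / L) ≤ p := by
    have h1 := Nat.div_mul_le_self n L
    refine le_of_mul_le_mul_left (a := L) ?_ (Nat.succ_pos _)
    calc L * (64 * n * (n / L)) = 64 * n * (n / L * L) := by ring
      _ ≤ 64 * n * n := Nat.mul_le_mul_left _ h1
      _ = 64 * n ^ 2 := by ring
      _ ≤ L * p := hLp'
  obtain ⟨m, hJ, z, H, hH, hHY, hsep⟩ := exists_card_le_shortGaps (L := L) hppos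
    (by rw [← hn, ← hp]; nlinarith)
  rw [← hp] at hJ hH
  set t := p ^ 2 / (1040 * n ^ 3) with ht
  have hn3 : 0 < 1040 * n ^ 3 := by positivity
  have ht8 : 8 ≤ t := by
    rw [ht, Nat.le_div_iff_mul_le hn3]
    linarith
  have htle : t * (1040 * n ^ 3) ≤ p ^ 2 := Nat.div_mul_le_self _ _
  have htge : p ^ 2 ≤ 1170 * n ^ 3 * t := by
    have := Nat.lt_div_mul_add (a := p ^ 2) hn3
    rw [← ht] at this
    have h8 := Nat.mul_le_mul_left (n ^ 3) ht8
    nlinarith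
  have hnLt : 16 * (n * L * t) ≤ p := by
    refine le_of_mul_le_mul_right (a := p) ?_ hppos
    calc 16 * (n * L * t) * p = 16 * n * t * (L * p) := by ring
      _ ≤ 16 * n * t * (65 * n ^ 2) := Nat.mul_le_mul_left _ hLp
      _ = t * (1040 * n ^ 3) := by ring
      _ ≤ p * p := by rw [← sq]; exact htle
  obtain ⟨r, hr, hmain⟩ := pow_mul_card_shortGaps_le (B := B) (Y := Y) (m := m) (H := H)
    (L := L) (t := t) (Nat.succ_pos _) ht8 (by omega) (by rw [← hn]; omega) hHY hsep
  rw [← hn] at hmain hH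
  rw [← hQ] at hr
  have hpr : p * r ≤ 16 * n * Q :=
    calc p * r ≤ 8 * n * #H * r := Nat.mul_le_mul_right _ hH
      _ = 8 * n * (#H * r) := by ring
      _ ≤ 8 * n * (2 * Q) := Nat.mul_le_mul_left _ hr
      _ = _ := by ring
  calc p ^ 14 = (p ^ 2) ^ 5 * p * p ^ 3 := by ring
    _ ≤ (1170 * n ^ 3 * t) ^ 5 * (8 * #(shortGaps B Y L m)) * p ^ 3 := by gcongr
    _ = 1170 ^ 5 * 8 * n ^ 15 * (t ^ 5 * #(shortGaps B Y L m)) * p ^ 3 := by ring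
    _ ≤ 1170 ^ 5 * 8 * n ^ 15 * (4 * 17 ^ 4 * (n * r) ^ 3) * p ^ 3 := by gcongr
    _ = 1170 ^ 5 * 32 * 17 ^ 4 * n ^ 18 * (p * r) ^ 3 := by ring
    _ ≤ 1170 ^ 5 * 32 * 17 ^ 4 * n ^ 18 * (16 * n * Q) ^ 3 := by gcongr
    _ = (1170 ^ 5 * 32 * 17 ^ 4 * 16 ^ 3) * n ^ 21 * Q ^ 3 := by ring
    _ ≤ 10 ^ 28 * n ^ 21 * Q ^ 3 := by gcongr; norm_num

lemma card_le_card_image_log (X : Finset ℝ) : #X ≤ 2 * #((X.erase 0).image Real.log) + 1 := by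
  have h : #(X.erase 0) ≤ 2 * #((X.erase 0).image Real.log) := by
    refine card_le_mul_card_image _ 2 fun y _ => ?_
    refine (card_le_card fun x hx => ?_).trans (card_le_two (a := Real.exp y) (b := -Real.exp y))
    obtain ⟨hx0, rfl⟩ := mem_filter.1 hx
    rw [Real.exp_log_eq_abs (mem_erase.1 hx0).1, mem_insert, mem_singleton]
    exact eq_or_eq_neg_of_abs_eq rfl
  have := pred_card_le_card_erase (s := X) (a := (0 : ℝ))
  omega

lemma card_image_log_add_le (X : Finset ℝ) :
    #((X.erase 0).image Real.log + (X.erase 0).image Real.log) ≤ #(X * X) := by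
  refine (card_le_card fun y hy => ?_).trans (card_image_le (f := Real.log))
  obtain ⟨u, hu, v, hv, rfl⟩ := mem_add.1 hy
  obtain ⟨a, ha, rfl⟩ := mem_image.1 hu
  obtain ⟨b, hb, rfl⟩ := mem_image.1 hv
  rw [mem_erase] at ha hb
  exact mem_image.2 ⟨a * b, mul_mem_mul ha.2 hb.2, Real.log_mul ha.1 hb.1⟩

lemma card_nsmul_sub_image_log_le {X : Finset ℝ} (hX : 2 ≤ #X) {K : ℝ}
    (hK : (#(X * X) : ℝ) ≤ K * #X) :
    (#(3 • (X.erase 0).image Real.log - 2 • (X.erase 0).image Real.log) : ℝ) ≤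
      (4 * K) ^ 5 * #X := by
  have h1 := card_le_card_image_log X
  have h2 := card_image_log_add_le X
  have h3 : #((X.erase 0).image Real.log) ≤ #X := card_image_le.trans (card_erase_le)
  set Y := (X.erase 0).image Real.log
  have hY : 0 < #Y := by omega
  have h4 : #X ≤ 4 * #Y := by omega
  have hpl : ((#(3 • Y - 2 • Y) : ℚ≥0) : ℝ) ≤ (((#(Y + Y) / #Y : ℚ≥0) ^ (3 + 2) * #Y : ℚ≥0) : ℝ) :=
    NNRat.cast_le.2 (pluennecke_ruzsa_inequality_nsmul_sub_nsmul_add (card_pos.1 hY) Y 3 2)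
  push_cast at hpl
  have hY' : (0 : ℝ) < #Y := by exact_mod_cast hY
  have hK0 : 0 ≤ K := by
    have : (0 : ℝ) < #X := by exact_mod_cast (by omega : 0 < #X)
    by_contra! h
    have := mul_neg_of_neg_of_pos h this
    linarith [Nat.cast_nonneg (α := ℝ) #(X * X)]
  have h5 : (#(Y + Y) : ℝ) / #Y ≤ 4 * K := by
    rw [div_le_iff₀ hY']
    calc (#(Y + Y) : ℝ) ≤ #(X * X) := by exact_mod_cast h2
      _ ≤ K * #X := hK
      _ ≤ K * (4 * #Y) := by gcongr; exact_mod_cast h4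
      _ = 4 * K * #Y := by ring
  refine hpl.trans ?_
  gcongr

lemma card_solutions_le (X B : Finset ℝ) :
    #{p ∈ B ×ˢ B ×ˢ X | p.1 + p.2.1 = p.2.2} ≤
      #(logSumPairs B ((X.erase 0).image Real.log)) +
        #(logSumPairs (-B) ((X.erase 0).image Real.log)) + #B := by
  set Y := (X.erase 0).image Real.log with hY
  let N : Finset (ℝ × ℝ) := (logSumPairs (-B) Y).image Neg.neg
  let D : Finset (ℝ × ℝ) := B.image fun b => (b, -b)
  calc #{p ∈ B ×ˢ B ×ˢ X | p.1 + p.2.1 = p.2.2}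
      ≤ #(logSumPairs B Y ∪ N ∪ D) := by
        refine card_le_card_of_injOn (fun p => (p.1, p.2.1)) ?_ ?_
        · rintro ⟨a, b, x⟩ h
          simp only [mem_coe, mem_filter, mem_product] at h
          obtain ⟨⟨ha, hb, hx⟩, rfl⟩ := h
          simp only [mem_coe, mem_union]
          rcases lt_trichotomy 0 (a + b) with h | h | h
          · refine Or.inl (Or.inl ?_)
            simp only [logSumPairs, mem_filter, mem_product]
            exact ⟨⟨ha, hb⟩, h, mem_image_of_mem _ (mem_erase.2 ⟨h.ne', hx⟩)⟩
          · exact Or.inr (mem_image.2 ⟨a, ha, Prod.ext rfl (by simp only; linarith)⟩)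
          · refine Or.inl (Or.inr (mem_image.2 ⟨(-a, -b), ?_, by simp⟩))
            simp only [logSumPairs, mem_filter, mem_product, ← neg_add,
              Real.log_neg_eq_log, neg_pos]
            exact ⟨⟨neg_mem_neg ha, neg_mem_neg hb⟩, h,
              mem_image_of_mem _ (mem_erase.2 ⟨h.ne, hx⟩)⟩
        · rintro ⟨a, b, x⟩ h ⟨a', b', x'⟩ h' heq
          simp only [mem_coe, mem_filter, Prod.mk.injEq] at h h' heq ⊢
          refine ⟨heq.1, heq.2, ?_⟩
          rw [← h.2, ← h'.2, heq.1, heq.2]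
    _ ≤ #(logSumPairs B Y) + #N + #D :=
        (card_union_le _ _).trans (Nat.add_le_add_right (card_union_le _ _) _)
    _ ≤ _ := Nat.add_le_add (Nat.add_le_add_left card_image_le _) card_image_le

lemma card_logSumPairs_le {B Y : Finset ℝ} {N : ℝ} (hN : 0 ≤ N)
    (hY : (#(3 • Y - 2 • Y) : ℝ) ≤ 4 ^ 5 * N ^ (21 / 20 : ℝ)) :
    (#(logSumPairs B Y) : ℝ) ≤ 800 * (#B : ℝ) ^ (3 / 2 : ℝ) * N ^ (9 / 40 : ℝ) := by
  have h1 : (#(logSumPairs B Y) : ℝ) ^ 14 ≤ 10 ^ 28 * #B ^ 21 * #(3 • Y - 2 • Y) ^ 3 := by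
    exact_mod_cast card_logSumPairs_pow_le B Y
  refine le_of_pow_le_pow_left₀ (n := 14) (by norm_num) (by positivity) (h1.trans ?_)
  have h2 : ((#B : ℝ) ^ (3 / 2 : ℝ)) ^ 14 = (#B : ℝ) ^ 21 := by
    rw [← Real.rpow_natCast, ← Real.rpow_mul (by positivity), ← Real.rpow_natCast]
    norm_num
  have h3 : (N ^ (9 / 40 : ℝ)) ^ 14 = (N ^ (21 / 20 : ℝ)) ^ 3 := by
    rw [← Real.rpow_natCast, ← Real.rpow_mul hN, ← Real.rpow_natCast, ← Real.rpow_mul hN]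
    norm_num
  rw [mul_pow, mul_pow, h2, h3]
  calc (10 : ℝ) ^ 28 * #B ^ 21 * #(3 • Y - 2 • Y) ^ 3
      ≤ 10 ^ 28 * #B ^ 21 * (4 ^ 5 * N ^ (21 / 20 : ℝ)) ^ 3 := by gcongr
    _ = 10 ^ 28 * (4 ^ 5) ^ 3 * #B ^ 21 * (N ^ (21 / 20 : ℝ)) ^ 3 := by ring
    _ ≤ 800 ^ 14 * #B ^ 21 * (N ^ (21 / 20 : ℝ)) ^ 3 := by gcongr; norm_num

lemma card_solutions_le_rpow {X B : Finset ℝ} (hX : 2 ≤ #X) (hB : B.Nonempty)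
    (h : (#(X * X) : ℝ) ≤ (#X : ℝ) ^ (1 + 1 / 100 : ℝ)) :
    (#{p ∈ B ×ˢ B ×ˢ X | p.1 + p.2.1 = p.2.2} : ℝ) ≤
      1601 * (#B : ℝ) ^ (17 / 10 : ℝ) * (#X : ℝ) ^ (3 / 20 - 1 / 100 : ℝ) := by
  have hX1 : (1 : ℝ) ≤ #X := by exact_mod_cast (by omega : 1 ≤ #X)
  have hX0 : (0 : ℝ) < #X := by linarith
  have hB1 : (1 : ℝ) ≤ #B := by exact_mod_cast card_pos.2 hB
  have hB0 : (0 : ℝ) < #B := by linarith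
  rcases le_total (#B : ℝ) ((#X : ℝ) ^ (9 / 20 : ℝ)) with hle | hge
  · have h1 : #{p ∈ B ×ˢ B ×ˢ X | p.1 + p.2.1 = p.2.2} ≤ #(B ×ˢ B) := by
      refine card_le_card_of_injOn (fun p => (p.1, p.2.1)) ?_ ?_
      · intro p hp
        simp only [mem_coe, mem_filter, mem_product] at hp ⊢
        exact ⟨hp.1.1, hp.1.2.1⟩
      · rintro ⟨a, b, x⟩ h ⟨a', b', x'⟩ h' heq
        simp only [mem_coe, mem_filter, Prod.mk.injEq] at h h' heq ⊢
        refine ⟨heq.1, heq.2, ?_⟩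
        rw [← h.2, ← h'.2, heq.1, heq.2]
    have h2 : (#B : ℝ) ^ (3 / 10 : ℝ) ≤ (#X : ℝ) ^ (3 / 20 - 1 / 100 : ℝ) :=
      calc (#B : ℝ) ^ (3 / 10 : ℝ) ≤ ((#X : ℝ) ^ (9 / 20 : ℝ)) ^ (3 / 10 : ℝ) := by gcongr
        _ = (#X : ℝ) ^ (27 / 200 : ℝ) := by rw [← Real.rpow_mul hX0.le]; norm_num
        _ ≤ _ := Real.rpow_le_rpow_of_exponent_le hX1 (by norm_num)
    calc (#{p ∈ B ×ˢ B ×ˢ X | p.1 + p.2.1 = p.2.2} : ℝ) ≤ #(B ×ˢ B) := by exact_mod_cast h1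
      _ = 1 * ((#B : ℝ) ^ (17 / 10 : ℝ) * (#B : ℝ) ^ (3 / 10 : ℝ)) := by
        rw [card_product, ← Real.rpow_add hB0]
        norm_num [sq]
      _ ≤ 1601 * ((#B : ℝ) ^ (17 / 10 : ℝ) * (#X : ℝ) ^ (3 / 20 - 1 / 100 : ℝ)) := by
        gcongr; norm_num
      _ = _ := by ring
  · have hQ : (#(3 • (X.erase 0).image Real.log - 2 • (X.erase 0).image Real.log) : ℝ) ≤
        4 ^ 5 * (#X : ℝ) ^ (21 / 20 : ℝ) := by
      have hK : (#(X * X) : ℝ) ≤ (#X : ℝ) ^ (1 / 100 : ℝ) * #X := by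
        rwa [add_comm, Real.rpow_add hX0, Real.rpow_one] at h
      refine (card_nsmul_sub_image_log_le hX hK).trans_eq ?_
      rw [mul_pow, ← Real.rpow_natCast, ← Real.rpow_natCast, ← Real.rpow_mul hX0.le, mul_assoc,
        ← Real.rpow_add_one hX0.ne']
      norm_num
    have h1 := card_logSumPairs_le (B := B) hX0.le hQ
    have h2 := card_logSumPairs_le (B := -B) hX0.le hQ
    rw [card_neg] at h2
    have h3 : (#B : ℝ) ≤ (#B : ℝ) ^ (3 / 2 : ℝ) * (#X : ℝ) ^ (9 / 40 : ℝ) :=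
      calc (#B : ℝ) = (#B : ℝ) ^ (1 : ℝ) * 1 := by simp
        _ ≤ _ := by
          gcongr
          · norm_num
          · exact Real.one_le_rpow hX1 (by norm_num)
    have h4 : (#X : ℝ) ^ (9 / 40 : ℝ) ≤
        (#B : ℝ) ^ (1 / 5 : ℝ) * (#X : ℝ) ^ (3 / 20 - 1 / 100 : ℝ) :=
      calc (#X : ℝ) ^ (9 / 40 : ℝ) ≤ (#X : ℝ) ^ (9 / 100 + (3 / 20 - 1 / 100) : ℝ) :=
            Real.rpow_le_rpow_of_exponent_le hX1 (by norm_num)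
        _ = ((#X : ℝ) ^ (9 / 20 : ℝ)) ^ (1 / 5 : ℝ) * (#X : ℝ) ^ (3 / 20 - 1 / 100 : ℝ) := by
          rw [Real.rpow_add hX0, ← Real.rpow_mul hX0.le]
          norm_num
        _ ≤ _ := by gcongr
    have h5 : (#{p ∈ B ×ˢ B ×ˢ X | p.1 + p.2.1 = p.2.2} : ℝ) ≤
        #(logSumPairs B ((X.erase 0).image Real.log)) +
          #(logSumPairs (-B) ((X.erase 0).image Real.log)) + #B := by
      exact_mod_cast card_solutions_le X B
    calc _ ≤ 1601 * ((#B : ℝ) ^ (3 / 2 : ℝ) * (#X : ℝ) ^ (9 / 40 : ℝ)) := by linarith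
      _ ≤ 1601 * ((#B : ℝ) ^ (3 / 2 : ℝ) *
          ((#B : ℝ) ^ (1 / 5 : ℝ) * (#X : ℝ) ^ (3 / 20 - 1 / 100 : ℝ))) := by gcongr
      _ = 1601 * ((#B : ℝ) ^ (3 / 2 + 1 / 5 : ℝ) * (#X : ℝ) ^ (3 / 20 - 1 / 100 : ℝ)) := by
        rw [Real.rpow_add hB0]; ring
      _ = _ := by norm_num [mul_assoc]

theorem stmt_2 :
    ∃ c c' C : ℝ, 0 < c ∧ 0 < c' ∧ 0 < C ∧ ∀ X B : Finset ℝ,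
      2 ≤ X.card → B.Nonempty →
      ((X * X).card : ℝ) ≤ (X.card : ℝ) ^ ((1 : ℝ) + c) →
      ((((B ×ˢ B ×ˢ X).filter fun p => p.1 + p.2.1 = p.2.2).card : ℝ))
        ≤ C * (B.card : ℝ) ^ ((17 : ℝ) / 10) *
            (X.card : ℝ) ^ ((3 : ℝ) / 20 - c') *
            (Real.logb 2 ((X.card : ℝ) * (B.card : ℝ))) ^ C := by
  refine ⟨1 / 100, 1 / 100, 1601, by norm_num, by norm_num, by norm_num, fun X B hX hB h => ?_⟩
  have hlog : 1 ≤ Real.logb 2 ((#X : ℝ) * #B) := by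
    have h2 : (2 : ℝ) ≤ (#X : ℝ) * #B := by
      exact_mod_cast hX.trans (Nat.le_mul_of_pos_right _ (card_pos.2 hB))
    rw [Real.le_logb_iff_rpow_le one_lt_two (by linarith), Real.rpow_one]
    exact h2
  refine (card_solutions_le_rpow hX hB h).trans ?_
  exact le_mul_of_one_le_right (by positivity) (Real.one_le_rpow hlog (by norm_num))
end
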